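/- arXiv:2007.08959 — 6 statements merged into one kernel-verified Lean document; each statement's English description precedes it below -/
import Mathlib

section
/- Let K ⊆ ℝ^n be a closed nonempty set and let x ∈ ℝ^n ∖ K. Then the distance function δ_K is differentiable at x if and only if the nearest-point set ξ_K(x) is a singleton {a} and, in that case, the gradient satisfies ∇δ_K(x) = (x − a)/δ_K(x). -/
open Metric in
/-- At a point of differentiability of the distance function off `K`, the derivative is that of
the distance to any nearest point. -/
theorem hasGradientAt_infDist_of_differentiableAt {E : Type*} [NormedAddCommGroup E]
    [InnerProductSpace ℝ E] [CompleteSpace E] {K : Set E} {x a : E} (ha : a ∈ K)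
    (hxa : dist x a = infDist x K) (hx : x ∉ K)
    (hf : DifferentiableAt ℝ (fun y => infDist y K) x) :
    HasGradientAt (fun y => infDist y K) ((infDist x K)⁻¹ • (x - a)) x := by
  have hne : x - a ≠ 0 := sub_ne_zero.2 fun h => hx (h ▸ ha)
  have hsq : HasFDerivAt (fun y => ‖y - a‖ ^ 2) ((2 : ℝ) • innerSL ℝ (x - a)) x := by
    simpa [← Nat.cast_smul_eq_nsmul ℝ] using ((hasFDerivAt_id x).sub_const a).norm_sq
  have hd : HasFDerivAt (fun y => dist y a) ((infDist x K)⁻¹ • innerSL ℝ (x - a)) x := by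
    have h := hsq.sqrt (by positivity)
    simp only [Real.sqrt_sq (norm_nonneg _), smul_smul] at h
    simp only [dist_eq_norm] at hxa ⊢
    convert h using 2
    rw [hxa]
    ring
  have hmin : IsLocalMin (fun y => dist y a - infDist y K) x :=
    Filter.Eventually.of_forall fun y => by
      simpa [hxa] using infDist_le_dist_of_mem (x := y) ha
  have h0 := hmin.hasFDerivAt_eq_zero (hd.sub hf.hasFDerivAt)
  rw [hasGradientAt_iff_hasFDerivAt]
  refine hf.hasFDerivAt.congr_fderiv ?_
  rw [← sub_eq_zero.1 h0]
  ext v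
  simp

open Metric in
/-- If `a` is the only nearest point of the closed set `K` to `x`, then nearest points to `y`
are close to `a` when `y` is close to `x`. -/
theorem exists_forall_dist_lt_of_unique_nearest {E : Type*} [MetricSpace E] [ProperSpace E]
    {K : Set E} (hK : IsClosed K) {x a : E}
    (huniq : ∀ b ∈ K, dist x b = infDist x K → b = a) {ε : ℝ} (hε : 0 < ε) :
    ∃ δ > 0, ∀ y, dist y x < δ → ∀ b ∈ K, dist y b = infDist y K → dist b a < ε := by
  rcases (K \ ball a ε).eq_empty_or_nonempty with h | h
  · exact ⟨1, one_pos, fun y _ b hb _ => Set.sdiff_eq_empty.1 h hb⟩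
  obtain ⟨c, ⟨hcK, hcb⟩, hc⟩ := (hK.sdiff isOpen_ball).exists_infDist_eq_dist h x
  have hlt : infDist x K < dist x c := by
    refine (infDist_le_dist_of_mem hcK).lt_of_ne fun heq => hcb ?_
    rw [huniq c hcK heq.symm]
    exact mem_ball_self hε
  refine ⟨(dist x c - infDist x K) / 2, by linarith, fun y hy b hb hyb => ?_⟩
  by_contra hba
  have h1 : dist x c ≤ dist x b := hc ▸ infDist_le_dist_of_mem ⟨hb, hba⟩
  have h2 := dist_triangle x y b
  have h3 := infDist_le_infDist_add_dist (s := K) (x := y) (y := x)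
  rw [dist_comm x y] at h2
  linarith

open Metric in
/-- The squared distance function is differentiable where the nearest point is unique. -/
theorem hasFDerivAt_infDist_sq_of_unique_nearest {E : Type*} [NormedAddCommGroup E]
    [InnerProductSpace ℝ E] [ProperSpace E] {K : Set E} (hK : IsClosed K) {x a : E}
    (ha : a ∈ K) (hxa : dist x a = infDist x K)
    (huniq : ∀ b ∈ K, dist x b = infDist x K → b = a) :
    HasFDerivAt (fun y => infDist y K ^ 2) ((2 : ℝ) • innerSL ℝ (x - a)) x := by
  rw [hasFDerivAt_iff_isLittleO, Asymptotics.isLittleO_iff]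
  intro ε hε
  obtain ⟨δ, hδ, hclose⟩ := exists_forall_dist_lt_of_unique_nearest hK huniq (half_pos hε)
  filter_upwards [ball_mem_nhds x (lt_min hδ hε)] with y hy
  obtain ⟨b, hb, hyb⟩ := hK.exists_infDist_eq_dist ⟨a, ha⟩ y
  have hy' : dist y x < min δ ε := hy
  have hba := (hclose y (hy'.trans_le (min_le_left _ _)) b hb hyb.symm).le
  have hyx := (hy'.trans_le (min_le_right _ _)).le
  have hexpand : ∀ c, dist y c ^ 2 =
      dist x c ^ 2 + 2 * inner ℝ (x - c) (y - x) + ‖y - x‖ ^ 2 := fun c => by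
    rw [dist_eq_norm, dist_eq_norm, ← norm_add_sq_real]
    congr 2
    abel
  have hupper : infDist y K ^ 2 ≤ dist y a ^ 2 :=
    pow_le_pow_left₀ infDist_nonneg (infDist_le_dist_of_mem ha) 2
  have hlower : infDist x K ^ 2 ≤ dist x b ^ 2 :=
    pow_le_pow_left₀ infDist_nonneg (infDist_le_dist_of_mem hb) 2
  rw [hexpand a, hxa] at hupper
  have hyb2 := hexpand b
  rw [← hyb] at hyb2
  have hinner : inner ℝ (x - a) (y - x) - inner ℝ (x - b) (y - x) ≤ dist b a * ‖y - x‖ := by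
    rw [← inner_sub_left, sub_sub_sub_cancel_left, dist_eq_norm]
    exact real_inner_le_norm _ _
  rw [dist_eq_norm y x] at hyx
  have hba' := mul_le_mul_of_nonneg_right hba (norm_nonneg (y - x))
  have hyx' := mul_le_mul_of_nonneg_right hyx (norm_nonneg (y - x))
  rw [Real.norm_eq_abs, abs_le]
  simp only [smul_apply, innerSL_apply_apply, smul_eq_mul]
  constructor <;> nlinarith [sq_nonneg ‖y - x‖]


/-- The set of nearest points of `K` to `x`. -/
def nearestPoints {n : ℕ} (K : Set (EuclideanSpace ℝ (Fin n)))
    (x : EuclideanSpace ℝ (Fin n)) : Set (EuclideanSpace ℝ (Fin n)) :=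
  {a | a ∈ K ∧ dist x a = Metric.infDist x K}

/-- Let `K ⊆ ℝ^n` be a closed nonempty set and `x ∉ K`.  The distance function `δ_K` is
differentiable at `x` if and only if the nearest-point set `ξ_K(x)` is a singleton `{a}`, and
in that case the gradient satisfies `∇δ_K(x) = (x − a)/δ_K(x)`. -/
theorem distance_differentiable_iff_unique_nearest_point {n : ℕ}
    (K : Set (EuclideanSpace ℝ (Fin n))) (hK : IsClosed K) (hne : K.Nonempty)
    (x : EuclideanSpace ℝ (Fin n)) (hx : x ∉ K) :
    (DifferentiableAt ℝ (fun y => Metric.infDist y K) x ↔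
      ∃ a, nearestPoints K x = {a}) ∧
    ∀ a, nearestPoints K x = {a} →
      gradient (fun y => Metric.infDist y K) x = (Metric.infDist x K)⁻¹ • (x - a) := by
  obtain ⟨b, hb, hxb⟩ := hK.exists_infDist_eq_dist hne x
  have hpos : 0 < Metric.infDist x K := (hK.notMem_iff_infDist_pos hne).1 hx
  have hdiff : ∀ a, nearestPoints K x = {a} →
      DifferentiableAt ℝ (fun y => Metric.infDist y K) x := fun a hs => by
    have ha : a ∈ nearestPoints K x := hs ▸ Set.mem_singleton a
    have h := (hasFDerivAt_infDist_sq_of_unique_nearest hK ha.1 ha.2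
      fun c hc hxc => hs.subset ⟨hc, hxc⟩).differentiableAt.sqrt (by positivity)
    simpa only [Real.sqrt_sq Metric.infDist_nonneg] using h
  refine ⟨⟨fun hf => ⟨b, ?_⟩, fun ⟨a, hs⟩ => hdiff a hs⟩, fun a hs => ?_⟩
  · refine Set.eq_singleton_iff_unique_mem.2 ⟨⟨hb, hxb.symm⟩, fun c hc => ?_⟩
    have h := (hasGradientAt_infDist_of_differentiableAt hc.1 hc.2 hx hf).unique
      (hasGradientAt_infDist_of_differentiableAt hb hxb.symm hx hf)
    exact sub_right_injective (smul_right_injective _ (inv_ne_zero hpos.ne') h)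
  · have ha : a ∈ nearestPoints K x := hs ▸ Set.mem_singleton a
    exact (hasGradientAt_infDist_of_differentiableAt ha.1 ha.2 hx (hdiff a hs)).gradient
end

section
/- Let K ⊆ ℝ^n be a closed C^1-hypersurface, let Ω ⊆ ℝ^n be open with ∂Ω = K, let w ∈ Ω ∖ closure(Σ(K)) and let 0 < ε < δ_K(w) be such that the open ball U(w, ε) is contained in Ω ∖ closure(Σ(K)). Then the level set S = {x ∈ U(w, ε) : δ_K(x) = δ_K(w)} is a topological (n−1)-manifold. -/
/-- `σ` is a `C^1`-diffeomorphism from the open set `U` onto the open set `σ '' U`,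
with inverse `τ`. -/
def IsC1DiffeoOn {n : ℕ} (σ τ : EuclideanSpace ℝ (Fin n) → EuclideanSpace ℝ (Fin n))
    (U : Set (EuclideanSpace ℝ (Fin n))) : Prop :=
  IsOpen (σ '' U) ∧ ContDiffOn ℝ 1 σ U ∧ ContDiffOn ℝ 1 τ (σ '' U) ∧
    (∀ x ∈ U, τ (σ x) = x) ∧ (∀ y ∈ σ '' U, σ (τ y) = y)

/-- `M ⊆ ℝ^n` is a `C^1`-hypersurface. -/
def IsC1Hypersurface {n : ℕ} (M : Set (EuclideanSpace ℝ (Fin n))) : Prop :=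
  ∀ a ∈ M, ∃ U : Set (EuclideanSpace ℝ (Fin n)), IsOpen U ∧ a ∈ U ∧
    ∃ Z : Submodule ℝ (EuclideanSpace ℝ (Fin n)), Module.finrank ℝ Z = n - 1 ∧
      ∃ σ τ, IsC1DiffeoOn σ τ U ∧ σ '' (U ∩ M) = ↑Z ∩ σ '' U

/-- The singular set `Σ(K)` of the distance function from `K`: the set of points outside `K`
at which the distance function is not differentiable. -/
def singularSet {n : ℕ} (K : Set (EuclideanSpace ℝ (Fin n))) :
    Set (EuclideanSpace ℝ (Fin n)) :=
  {x | x ∉ K ∧ ¬ DifferentiableAt ℝ (fun y => Metric.infDist y K) x}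

open Filter Topology Metric

section DistanceFunction

variable {E : Type*} [NormedAddCommGroup E] [InnerProductSpace ℝ E] [CompleteSpace E]

lemma norm_gradient_infDist_le {K : Set E} {x : E}
    (h : DifferentiableAt ℝ (fun y => infDist y K) x) :
    ‖gradient (fun y => infDist y K) x‖ ≤ 1 := by
  have := h.hasFDerivAt.le_of_lipschitz (lipschitz_infDist_pt K)
  simpa [gradient] using this

/-- At a point of differentiability, the gradient of the distance function points away from any
nearest point. -/
lemma infDist_smul_gradient_eq_sub {K : Set E} {x a : E}
    (h : DifferentiableAt ℝ (fun y => infDist y K) x) (ha : a ∈ K)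
    (hxa : ‖x - a‖ ≤ infDist x K) :
    infDist x K • gradient (fun y => infDist y K) x = x - a := by
  have hxa' : ‖x - a‖ = infDist x K :=
    le_antisymm hxa (by simpa [dist_eq_norm] using infDist_le_dist_of_mem (x := x) ha)
  set g := gradient (fun y => infDist y K) x with hg
  have hline : HasDerivAt (fun t : ℝ => x + t • (a - x)) (a - x) 0 := by
    simpa using ((hasDerivAt_id (0 : ℝ)).smul_const (a - x)).const_add x
  have hcomp : HasDerivAt (fun t : ℝ => infDist (x + t • (a - x)) K - (1 - t) * infDist x K)
      (fderiv ℝ (fun y => infDist y K) x (a - x) - (-1) * infDist x K) 0 := by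
    have hx : HasFDerivAt (fun y => infDist y K) (fderiv ℝ (fun y => infDist y K) x)
        (x + (0 : ℝ) • (a - x)) := by simpa using h.hasFDerivAt
    exact (hx.comp_hasDerivAt (0 : ℝ) hline).sub
      (((hasDerivAt_id (0 : ℝ)).const_sub 1).mul_const (infDist x K))
  have hmax : IsLocalMax
      (fun t : ℝ => infDist (x + t • (a - x)) K - (1 - t) * infDist x K) 0 := by
    filter_upwards [eventually_lt_nhds (zero_lt_one' ℝ)] with t ht
    have h1 : infDist (x + t • (a - x)) K ≤ (1 - t) * ‖x - a‖ := by
      refine (infDist_le_dist_of_mem ha).trans_eq ?_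
      rw [dist_eq_norm, ← abs_of_pos (sub_pos.2 ht), ← Real.norm_eq_abs, ← norm_smul]
      congr 1
      module
    rw [hxa'] at h1
    simpa using h1
  have hzero := hmax.hasDerivAt_eq_zero hcomp
  have hinner : inner ℝ g (a - x) = -infDist x K := by
    rw [hg, gradient, InnerProductSpace.toDual_symm_apply]
    linarith
  have hinner' : inner ℝ g (x - a) = infDist x K := by
    rw [← neg_sub a x, inner_neg_right, hinner, neg_neg]
  have hle : ‖g‖ ≤ 1 := norm_gradient_infDist_le h
  have hsq : ‖infDist x K • g - (x - a)‖ ^ 2 ≤ 0 := by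
    rw [norm_sub_sq_real, norm_smul, inner_smul_left, hinner', hxa', Real.norm_eq_abs,
      abs_of_nonneg infDist_nonneg]
    simp only [conj_trivial]
    have : (infDist x K * ‖g‖) ^ 2 ≤ infDist x K ^ 2 :=
      pow_le_pow_left₀ (mul_nonneg infDist_nonneg (norm_nonneg _))
        (mul_le_of_le_one_right infDist_nonneg hle) 2
    nlinarith
  exact sub_eq_zero.1 (norm_eq_zero.1 (pow_eq_zero_iff two_ne_zero |>.1
    (le_antisymm hsq (by positivity))))

lemma sub_infDist_smul_gradient_mem [ProperSpace E] {K : Set E} (hK : IsClosed K)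
    (hne : K.Nonempty) {x : E} (h : DifferentiableAt ℝ (fun y => infDist y K) x) :
    x - infDist x K • gradient (fun y => infDist y K) x ∈ K := by
  obtain ⟨a, ha, hxa⟩ := hK.exists_infDist_eq_dist hne x
  rw [infDist_smul_gradient_eq_sub h ha (by rw [hxa, dist_eq_norm])]
  simpa using ha

/-- The gradient of the distance function is continuous on the interior of the set of points of
differentiability outside the closed set. -/
lemma continuousAt_gradient_infDist [ProperSpace E] {K : Set E} (hK : IsClosed K)
    (hne : K.Nonempty) {x : E} (hx : x ∉ K)
    (h : ∀ᶠ y in 𝓝 x, DifferentiableAt ℝ (fun y => infDist y K) y) :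
    ContinuousAt (gradient (fun y => infDist y K)) x := by
  have hpos : 0 < infDist x K := (hK.notMem_iff_infDist_pos hne).1 hx
  refine (isCompact_closedBall (0 : E) 1).tendsto_nhds_of_unique_mapClusterPt
    (h.mono fun y hy => by simpa using norm_gradient_infDist_le hy) fun q hq hcl => ?_
  obtain ⟨U, hU, hUq⟩ := mapClusterPt_iff_ultrafilter.1 hcl
  have hlim : Tendsto (fun y => y - infDist y K • gradient (fun y => infDist y K) y) U
      (𝓝 (x - infDist x K • q)) :=
    Tendsto.sub hU ((((continuous_infDist_pt K).tendsto x).mono_left hU).smul hUq)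
  have hmem : x - infDist x K • q ∈ K := hK.mem_of_tendsto hlim
    ((h.filter_mono hU).mono fun y hy => sub_infDist_smul_gradient_mem hK hne hy)
  have heq := infDist_smul_gradient_eq_sub h.self_of_nhds hmem (by
    rw [sub_sub_cancel, norm_smul, Real.norm_eq_abs, abs_of_pos hpos]
    exact mul_le_of_le_one_right hpos.le (by simpa using hq))
  rw [sub_sub_cancel] at heq
  exact (smul_right_injective E hpos.ne' heq).symm

lemma hasStrictFDerivAt_infDist [ProperSpace E] {K : Set E} (hK : IsClosed K)
    (hne : K.Nonempty) {x : E} (hx : x ∉ K)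
    (h : ∀ᶠ y in 𝓝 x, DifferentiableAt ℝ (fun y => infDist y K) y) :
    HasStrictFDerivAt (fun y => infDist y K) (fderiv ℝ (fun y => infDist y K) x) x := by
  refine hasStrictFDerivAt_of_hasFDerivAt_of_continuousAt (h.mono fun y hy => hy.hasFDerivAt) ?_
  have := (InnerProductSpace.toDual ℝ E).continuous.continuousAt.comp
    (continuousAt_gradient_infDist hK hne hx h)
  refine this.congr (Eventually.of_forall fun y => ?_)
  simp [gradient]

lemma fderiv_infDist_ne_zero [ProperSpace E] {K : Set E} (hK : IsClosed K)
    (hne : K.Nonempty) {x : E} (hx : x ∉ K)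
    (h : DifferentiableAt ℝ (fun y => infDist y K) x) :
    fderiv ℝ (fun y => infDist y K) x ≠ 0 := by
  intro h0
  have hmem := sub_infDist_smul_gradient_mem hK hne h
  simp [gradient, h0, hx] at hmem

end DistanceFunction

/-- Implicit function theorem: near a point with nonzero strict derivative, a level set of a real
function on an `n`-dimensional space is homeomorphic to an open subset of `ℝ^{n-1}`. -/
lemma HasStrictFDerivAt.exists_levelSet_homeomorph {E : Type*} [NormedAddCommGroup E]
    [NormedSpace ℝ E] [FiniteDimensional ℝ E] {f : E → ℝ} {f' : E →L[ℝ] ℝ} {B : Set E}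
    (hB : IsOpen B) {c : ℝ} (x : {y : E // y ∈ B ∧ f y = c})
    (hf : HasStrictFDerivAt f f' (x : E)) (hf' : f' ≠ 0) :
    ∃ (V : Set {y : E // y ∈ B ∧ f y = c})
      (W : Set (EuclideanSpace ℝ (Fin (Module.finrank ℝ E - 1)))),
        IsOpen V ∧ x ∈ V ∧ IsOpen W ∧ Nonempty (↥V ≃ₜ ↥W) := by
  have := FiniteDimensional.complete ℝ E
  have hrange : f'.range = ⊤ :=
    LinearMap.range_eq_top.2 (LinearMap.surjective (ContinuousLinearMap.coe_injective.ne hf'))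
  have hdim : Module.finrank ℝ f'.ker =
      Module.finrank ℝ (EuclideanSpace ℝ (Fin (Module.finrank ℝ E - 1))) := by
    have h1 := LinearMap.finrank_range_add_finrank_ker (f' : E →ₗ[ℝ] ℝ)
    have h2 : Module.finrank ℝ (f' : E →ₗ[ℝ] ℝ).range = 1 := by
      rw [hrange, finrank_top, Module.finrank_self]
    rw [finrank_euclideanSpace_fin]
    change Module.finrank ℝ (f' : E →ₗ[ℝ] ℝ).ker = _
    omega
  let L : f'.ker ≃L[ℝ] EuclideanSpace ℝ (Fin (Module.finrank ℝ E - 1)) :=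
    ContinuousLinearEquiv.ofFinrankEq hdim
  let e := hf.implicitToOpenPartialHomeomorph f f' hrange
  have he : ∀ y, (e y).1 = f y := fun _ => rfl
  have hcont : Continuous fun z => ((c, L.symm z) : ℝ × f'.ker) := by fun_prop
  let T : Set (ℝ × f'.ker) := e.target ∩ e.symm ⁻¹' B
  have hT : IsOpen T := e.isOpen_inter_preimage_symm hB
  refine ⟨Subtype.val ⁻¹' e.source, (fun z => ((c, L.symm z) : ℝ × f'.ker)) ⁻¹' T,
    e.open_source.preimage continuous_subtype_val,
    hf.mem_implicitToOpenPartialHomeomorph_source hrange, hT.preimage hcont, ⟨?_⟩⟩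
  have hpair : ∀ y, f y = c → (c, (e y).2) = e y := fun y hy =>
    Prod.ext ((he y).trans hy).symm rfl
  have hfst : ∀ z, (c, L.symm z) ∈ T → f (e.symm (c, L.symm z)) = c := fun z hz => by
    rw [← he, e.right_inv hz.1]
  exact
    { toFun := fun v => ⟨L (e v.1.1).2, by
        simp only [Set.mem_preimage, L.symm_apply_apply, hpair v.1.1 v.1.2.2]
        exact ⟨e.map_source v.2, by
          simpa only [Set.mem_preimage, e.left_inv v.2] using v.1.2.1⟩⟩
      invFun := fun z => ⟨⟨e.symm (c, L.symm z.1), z.2.2, hfst z.1 z.2⟩, e.map_target z.2.1⟩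
      left_inv := fun v => by
        apply Subtype.ext
        apply Subtype.ext
        simp only [L.symm_apply_apply, hpair v.1.1 v.1.2.2]
        exact e.left_inv v.2
      right_inv := fun z => by
        apply Subtype.ext
        simp only [e.right_inv z.2.1, L.apply_symm_apply]
      continuous_toFun := by
        refine Continuous.subtype_mk (L.continuous.comp (continuous_snd.comp ?_)) _
        exact e.continuousOn.comp_continuous
          (continuous_subtype_val.comp continuous_subtype_val) fun v => v.2
      continuous_invFun := by
        refine Continuous.subtype_mk (Continuous.subtype_mk ?_ _) _
        exact e.continuousOn_symm.comp_continuous (hcont.comp continuous_subtype_val)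
          fun z => z.2.1 }

/-- Under the hypotheses of the first half of the proof of the main theorem, the level set
`S = {x ∈ U(w, ε) : δ_K(x) = δ_K(w)}` is a topological `(n-1)`-manifold: every point of `S`
has an open neighbourhood (in `S`) homeomorphic to an open subset of `ℝ^{n-1}`.
(Hausdorffness is automatic for a subspace of `ℝ^n`.) -/
theorem level_set_is_manifold {n : ℕ}
    (K Ω : Set (EuclideanSpace ℝ (Fin n))) (hK : IsClosed K) (hsurf : IsC1Hypersurface K)
    (hΩ : IsOpen Ω) (hbd : frontier Ω = K)
    (w : EuclideanSpace ℝ (Fin n)) (hw : w ∈ Ω \ closure (singularSet K))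
    (ε : ℝ) (hε : 0 < ε) (hεδ : ε < Metric.infDist w K)
    (hball : Metric.ball w ε ⊆ Ω \ closure (singularSet K)) :
    ∀ x : {y : EuclideanSpace ℝ (Fin n) //
        y ∈ Metric.ball w ε ∧ Metric.infDist y K = Metric.infDist w K},
      ∃ (V : Set {y : EuclideanSpace ℝ (Fin n) //
            y ∈ Metric.ball w ε ∧ Metric.infDist y K = Metric.infDist w K})
        (W : Set (EuclideanSpace ℝ (Fin (n - 1)))),
        IsOpen V ∧ x ∈ V ∧ IsOpen W ∧ Nonempty (↥V ≃ₜ ↥W) := by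
 
  intro x
  have hne : K.Nonempty := by
    by_contra h
    rw [Set.not_nonempty_iff_eq_empty.1 h, infDist_empty] at hεδ
    exact hε.not_gt hεδ
  have hnotMem : ∀ y ∈ ball w ε, y ∉ K := fun y hy hyK => by
    rw [← hbd, hΩ.frontier_eq] at hyK
    exact hyK.2 (hball hy).1
  have hdiff : ∀ y ∈ ball w ε, DifferentiableAt ℝ (fun y => infDist y K) y := fun y hy => by
    by_contra h
    exact (hball hy).2 (subset_closure ⟨hnotMem y hy, h⟩)
  have hx := x.2.1
  have hev : ∀ᶠ y in 𝓝 (x : EuclideanSpace ℝ (Fin n)),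
      DifferentiableAt ℝ (fun y => infDist y K) y :=
    (isOpen_ball.eventually_mem hx).mono hdiff
  have key := (hasStrictFDerivAt_infDist hK hne (hnotMem _ hx) hev).exists_levelSet_homeomorph
    isOpen_ball x (fderiv_infDist_ne_zero hK hne (hnotMem _ hx) (hdiff _ hx))
  rwa [finrank_euclideanSpace_fin] at key
end

section
/- Let K ⊆ ℝ^n be a closed C^1-hypersurface and let x, y ∈ ℝ^n ∖ K satisfy δ_K(x) = δ_K(y) and |x − y| < 2 δ_K(x). If there exists a point a ∈ K with a ∈ ξ_K(x) and a ∈ ξ_K(y), then x = y. -/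
/-- The velocities at `a` of curves in a `C^1`-hypersurface `M` span a space of codimension at most
one: there is such a subspace `W` orthogonal to `x - a` for every `x` whose distance to the points
of `M` is minimal at `a`. -/
theorem IsC1Hypersurface.exists_submodule_inner_eq_zero {n : ℕ}
    {M : Set (EuclideanSpace ℝ (Fin n))} (hM : IsC1Hypersurface M)
    {a : EuclideanSpace ℝ (Fin n)} (ha : a ∈ M) :
    ∃ W : Submodule ℝ (EuclideanSpace ℝ (Fin n)), Module.finrank ℝ W = n - 1 ∧
      ∀ x, (∀ p ∈ M, dist x a ≤ dist x p) → ∀ w ∈ W, inner ℝ w (x - a) = 0 := by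
  obtain ⟨U, hU, haU, Z, hZ, σ, τ, ⟨hV, hσ, hτ, hτσ, hστ⟩, himg⟩ := hM a ha
  have hb : σ a ∈ σ '' U := ⟨a, haU, rfl⟩
  have hbZ : σ a ∈ (Z : Set _) ∩ σ '' U := himg ▸ ⟨a, ⟨haU, ha⟩, rfl⟩
  have hdτ : HasFDerivAt τ (fderiv ℝ τ (σ a)) (σ a) :=
    ((hτ.contDiffAt (hV.mem_nhds hb)).differentiableAt one_ne_zero).hasFDerivAt
  have hdσ : HasFDerivAt σ (fderiv ℝ σ a) (τ (σ a)) := by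
    rw [hτσ a haU]
    exact ((hσ.contDiffAt (hU.mem_nhds haU)).differentiableAt one_ne_zero).hasFDerivAt
  have hcomp : (fderiv ℝ σ a).comp (fderiv ℝ τ (σ a)) = ContinuousLinearMap.id ℝ _ :=
    (hdσ.comp (σ a) hdτ).unique ((hasFDerivAt_id (σ a)).congr_of_eventuallyEq
      (Filter.eventually_of_mem (hV.mem_nhds hb) hστ))
  have hinj : Function.Injective (fderiv ℝ τ (σ a)) :=
    Function.LeftInverse.injective (g := fderiv ℝ σ a) fun v => DFunLike.congr_fun hcomp v
  refine ⟨Z.map (fderiv ℝ τ (σ a) : _ →ₗ[ℝ] _), ?_, ?_⟩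
  · rw [← hZ]
    exact (Submodule.equivMapOfInjective _ hinj Z).finrank_eq.symm
  · rintro x hx _ ⟨z, hz, rfl⟩
    have hline : HasDerivAt (fun t : ℝ => σ a + t • z) z 0 := by
      simpa using ((hasDerivAt_id (0 : ℝ)).smul_const z).const_add (σ a)
    have hcurve : HasDerivAt (fun t : ℝ => τ (σ a + t • z)) (fderiv ℝ τ (σ a) z) 0 :=
      HasFDerivAt.comp_hasDerivAt (0 : ℝ) (by simpa using hdτ) hline
    have hmin : IsLocalMin (fun t : ℝ => ‖x - τ (σ a + t • z)‖ ^ 2) 0 := by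
      have hmem : ∀ᶠ t in nhds (0 : ℝ), σ a + t • z ∈ σ '' U :=
        hline.continuousAt.eventually_mem (hV.mem_nhds (by simpa using hb))
      filter_upwards [hmem] with t ht
      obtain ⟨p, ⟨hpU, hpM⟩, hp⟩ : σ a + t • z ∈ σ '' (U ∩ M) :=
        himg ▸ ⟨Z.add_mem hbZ.1 (Z.smul_mem t hz), ht⟩
      have hle := hx p hpM
      rw [← hp, hτσ p hpU, zero_smul, add_zero, hτσ a haU]
      rw [dist_eq_norm, dist_eq_norm] at hle
      gcongr
    have hzero := hmin.hasDerivAt_eq_zero (hcurve.const_sub x).norm_sq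
    simp only [zero_smul, add_zero, hτσ a haU, inner_neg_right] at hzero
    rw [real_inner_comm]
    change inner ℝ (x - a) (fderiv ℝ τ (σ a) z) = 0
    linarith

/-- Two vectors of equal norm in a space of dimension at most one are equal or opposite. -/
theorem eq_or_eq_neg_of_norm_eq_of_finrank_le_one {E : Type*} [NormedAddCommGroup E]
    [NormedSpace ℝ E] [FiniteDimensional ℝ E] (hE : Module.finrank ℝ E ≤ 1) {u v : E}
    (h : ‖u‖ = ‖v‖) : u = v ∨ u = -v := by
  obtain ⟨e, he⟩ := finrank_le_one_iff.mp hE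
  obtain ⟨c, rfl⟩ := he u
  obtain ⟨d, rfl⟩ := he v
  rcases eq_or_ne e 0 with rfl | hne
  · simp
  · rw [norm_smul, norm_smul] at h
    have hcd : |c| = |d| := mul_right_cancel₀ (norm_ne_zero_iff.mpr hne) h
    rcases abs_eq_abs.mp hcd with rfl | rfl <;> simp

/-- For a closed `C^1`-hypersurface `K`, two points `x, y ∉ K` that are equidistant from `K`,
closer to each other than `2 δ_K(x)`, and share a common nearest point in `K`, coincide. -/
theorem eq_of_common_nearest_point {n : ℕ}
    (K : Set (EuclideanSpace ℝ (Fin n))) (hK : IsClosed K) (hsurf : IsC1Hypersurface K)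
    (x y : EuclideanSpace ℝ (Fin n)) (hx : x ∉ K) (hy : y ∉ K)
    (hdist : Metric.infDist x K = Metric.infDist y K)
    (hclose : dist x y < 2 * Metric.infDist x K)
    (a : EuclideanSpace ℝ (Fin n)) (hax : a ∈ nearestPoints K x)
    (hay : a ∈ nearestPoints K y) :
    x = y := by
  obtain ⟨haK, hxa⟩ := hax
  obtain ⟨-, hya⟩ := hay
  obtain ⟨W, hW, hperp⟩ := hsurf.exists_submodule_inner_eq_zero haK
  have hfin : Module.finrank ℝ Wᗮ ≤ 1 := by
    have hsum := W.finrank_add_finrank_orthogonal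
    rw [hW, finrank_euclideanSpace_fin] at hsum
    omega
  have hxW : x - a ∈ Wᗮ := (W.mem_orthogonal _).mpr
    (hperp x fun p hp => hxa.trans_le (Metric.infDist_le_dist_of_mem hp))
  have hyW : y - a ∈ Wᗮ := (W.mem_orthogonal _).mpr
    (hperp y fun p hp => hya.trans_le (Metric.infDist_le_dist_of_mem hp))
  have hnorm : ‖(⟨x - a, hxW⟩ : Wᗮ)‖ = ‖(⟨y - a, hyW⟩ : Wᗮ)‖ := by
    rw [Submodule.coe_norm, Submodule.coe_norm, ← dist_eq_norm, ← dist_eq_norm, hxa, hya, hdist]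
  rcases eq_or_eq_neg_of_norm_eq_of_finrank_le_one hfin hnorm with h | h
  · exact sub_left_injective (congrArg Subtype.val h)
  · have hneg : x - a = -(y - a) := congrArg Subtype.val h
    have hxy : x - y = (2 : ℝ) • (x - a) := by
      rw [two_smul]
      nth_rewrite 2 [hneg]
      abel
    rw [dist_eq_norm, hxy, norm_smul, ← dist_eq_norm, hxa, Real.norm_ofNat] at hclose
    exact absurd hclose (lt_irrefl _)
end

section
/- Let K ⊆ ℝ^n be a closed and connected C^1-hypersurface such that H^{n−1}(K ∩ M) = 0 whenever M is a C^2-hypersurface of ℝ^n, where H^{n−1} denotes the (n−1)-dimensional Hausdorff measure. Then closure(Σ(K)) = ℝ^n, i.e. the singular set of the distance function δ_K is dense in ℝ^n. -/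
/-- `σ` is a `C^2`-diffeomorphism from the open set `U` onto the open set `σ '' U`,
with inverse `τ`. -/
def IsC2DiffeoOn {n : ℕ} (σ τ : EuclideanSpace ℝ (Fin n) → EuclideanSpace ℝ (Fin n))
    (U : Set (EuclideanSpace ℝ (Fin n))) : Prop :=
  IsOpen (σ '' U) ∧ ContDiffOn ℝ 2 σ U ∧ ContDiffOn ℝ 2 τ (σ '' U) ∧
    (∀ x ∈ U, τ (σ x) = x) ∧ (∀ y ∈ σ '' U, σ (τ y) = y)

/-- `M ⊆ ℝ^n` is a `C^2`-hypersurface. -/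
def IsC2Hypersurface {n : ℕ} (M : Set (EuclideanSpace ℝ (Fin n))) : Prop :=
  ∀ a ∈ M, ∃ U : Set (EuclideanSpace ℝ (Fin n)), IsOpen U ∧ a ∈ U ∧
    ∃ Z : Submodule ℝ (EuclideanSpace ℝ (Fin n)), Module.finrank ℝ Z = n - 1 ∧
      ∃ σ τ, IsC2DiffeoOn σ τ U ∧ σ '' (U ∩ M) = ↑Z ∩ σ '' U

open MeasureTheory Set Filter Topology Metric
open scoped Convolution ContDiff NNReal ENNReal RealInnerProductSpace

section Mollify

variable {E : Type} [NormedAddCommGroup E] [InnerProductSpace ℝ E] [FiniteDimensional ℝ E]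
  [MeasurableSpace E] [BorelSpace E]

theorem norm_iteratedFDeriv_convolution_le (j : ℕ) :
    ∀ {F G : Type} [NormedAddCommGroup F] [NormedSpace ℝ F] [NormedAddCommGroup G]
      [NormedSpace ℝ G] (L : F →L[ℝ] ℝ →L[ℝ] G) {k : E → F},
      ContDiff ℝ ∞ k → HasCompactSupport k → tsupport k ⊆ closedBall 0 1 →
      ∃ C : ℝ, 0 ≤ C ∧ ∀ (h : E → ℝ) (x : E) (B : ℝ), Continuous h →
        (∀ y ∈ closedBall x 1, |h y| ≤ B) →
        ‖iteratedFDeriv ℝ j (k ⋆[L, volume] h) x‖ ≤ C * B := by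
  induction j with
  | zero =>
    intro F G _ _ _ _ L k hk hkc hks
    refine ⟨∫ t, ‖L‖ * ‖k t‖, integral_nonneg fun t => by positivity, fun h x B hh hB => ?_⟩
    have hB0 : 0 ≤ B := (abs_nonneg _).trans (hB x (mem_closedBall_self zero_le_one))
    rw [norm_iteratedFDeriv_zero, convolution_def, ← integral_mul_const]
    refine norm_integral_le_of_norm_le ?_ (ae_of_all _ fun t => ?_)
    · exact ((hk.continuous.integrable_of_hasCompactSupport hkc).norm.const_mul _).mul_const _
    · by_cases ht : t ∈ closedBall (0 : E) 1
      · calc ‖L (k t) (h (x - t))‖ ≤ ‖L‖ * ‖k t‖ * ‖h (x - t)‖ := L.le_opNorm₂ _ _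
          _ ≤ _ := by
            gcongr
            exact hB _ (by simpa [dist_eq_norm] using ht)
      · have : k t = 0 := image_eq_zero_of_notMem_tsupport fun h' => ht (hks h')
        simp [this]
  | succ j ih =>
    intro F G _ _ _ _ L k hk hkc hks
    obtain ⟨C, hC, H⟩ := ih (L.precompL E) (k := fderiv ℝ k)
      (hk.fderiv_right (by simp)) (hkc.fderiv ℝ) ((tsupport_fderiv_subset ℝ).trans hks)
    refine ⟨C, hC, fun h x B hh hB => ?_⟩
    rw [← norm_iteratedFDeriv_fderiv]
    have : fderiv ℝ (k ⋆[L, volume] h) = (fderiv ℝ k ⋆[L.precompL E, volume] h) := by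
      ext1 y
      exact (hkc.hasFDerivAt_convolution_left L (hk.of_le (by simp)) hh.locallyIntegrable y).fderiv
    rw [this]
    exact H h x B hh hB

/-- The mollification of `h` at scale `s` with kernel `η`. -/
noncomputable def mollify (η : E → ℝ) (s : ℝ) (h : E → ℝ) (x : E) : ℝ :=
  ∫ y, η y * h (x - s • y)

theorem mollify_eq_convolution (η : E → ℝ) {s : ℝ} (hs : s ≠ 0) (h : E → ℝ) :
    mollify η s h = fun x =>
      (η ⋆[ContinuousLinearMap.mul ℝ ℝ, volume] fun y => h (s • y)) (s⁻¹ • x) := by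
  ext x
  simp [mollify, convolution_def, smul_sub, smul_smul, hs]

theorem contDiff_mollify {η : E → ℝ} (hη : ContDiff ℝ ∞ η) (hc : HasCompactSupport η) {s : ℝ}
    (hs : s ≠ 0) {h : E → ℝ} (hh : Continuous h) : ContDiff ℝ ∞ (mollify η s h) := by
  rw [mollify_eq_convolution η hs]
  have : Continuous fun y => h (s • y) := by fun_prop
  exact (hc.contDiff_convolution_left _ hη this.locallyIntegrable).comp
    (contDiff_const_smul s⁻¹)

theorem norm_iteratedFDeriv_mollify_le {η : E → ℝ} (hη : ContDiff ℝ ∞ η)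
    (hc : HasCompactSupport η) (hsupp : tsupport η ⊆ closedBall 0 1) (j : ℕ) :
    ∃ C : ℝ, 0 ≤ C ∧ ∀ (h : E → ℝ) (x : E) (B s : ℝ), Continuous h → 0 < s →
      (∀ y ∈ closedBall x s, |h y| ≤ B) →
      ‖iteratedFDeriv ℝ j (mollify η s h) x‖ ≤ C * B / s ^ j := by
  obtain ⟨C, hC, H⟩ := norm_iteratedFDeriv_convolution_le j (ContinuousLinearMap.mul ℝ ℝ)
    hη hc hsupp
  refine ⟨C, hC, fun h x B s hh hs hB => ?_⟩
  have hh' : Continuous fun y => h (s • y) := by fun_prop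
  rw [mollify_eq_convolution η hs.ne', iteratedFDeriv_comp_const_smul (f := 
    (η ⋆[ContinuousLinearMap.mul ℝ ℝ, volume] fun y => h (s • y))) _
    ((hc.contDiff_convolution_left _ hη hh'.locallyIntegrable).of_le (by exact_mod_cast le_top)),
    norm_smul, div_eq_inv_mul, norm_pow, norm_inv, Real.norm_of_nonneg hs.le, inv_pow]
  gcongr
  refine H _ _ _ hh' fun y hy => hB _ ?_
  rw [mem_closedBall, dist_eq_norm] at hy ⊢
  calc ‖s • y - x‖ = ‖s • (y - s⁻¹ • x)‖ := by rw [smul_sub, smul_smul, mul_inv_cancel₀ hs.ne', one_smul]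
    _ = s * ‖y - s⁻¹ • x‖ := by rw [norm_smul, Real.norm_of_nonneg hs.le]
    _ ≤ s := by nlinarith

theorem integrable_mul_of_hasCompactSupport {η h : E → ℝ} (hη : Continuous η)
    (hc : HasCompactSupport η) (hh : Continuous h) : Integrable fun y => η y * h y :=
  (hη.mul hh).integrable_of_hasCompactSupport hc.mul_right

theorem mollify_sub {η : E → ℝ} (hη : Continuous η) (hc : HasCompactSupport η) (s : ℝ)
    {h k : E → ℝ} (hh : Continuous h) (hk : Continuous k) :
    mollify η s (h - k) = mollify η s h - mollify η s k := by
  ext x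
  simp only [mollify, Pi.sub_apply, mul_sub]
  exact integral_sub (integrable_mul_of_hasCompactSupport hη hc (by fun_prop))
    (integrable_mul_of_hasCompactSupport hη hc (by fun_prop))

/-- A function of the form `w ↦ a + L w + Q w w`. -/
def IsQuadraticPolynomial (T : E → ℝ) : Prop :=
  ∃ (a : ℝ) (L : E →L[ℝ] ℝ) (Q : E →L[ℝ] E →L[ℝ] ℝ), T = fun w => a + L w + Q w w

omit [FiniteDimensional ℝ E] [MeasurableSpace E] [BorelSpace E] in
theorem IsQuadraticPolynomial.contDiff {T : E → ℝ} (hT : IsQuadraticPolynomial T) {n : ℕ∞ω} :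
    ContDiff ℝ n T := by
  obtain ⟨a, L, Q, rfl⟩ := hT
  fun_prop

theorem integral_eq_zero_of_odd {f : E → ℝ} (hf : ∀ y, f (-y) = -f y) : ∫ y, f y = 0 := by
  have h := integral_neg_eq_self f (volume : Measure E)
  simp only [hf, integral_neg] at h
  linarith

/-- A smooth kernel whose mollifications reproduce quadratic polynomials. -/
theorem exists_kernel_reproducing_quadratic :
    ∃ η : E → ℝ, ContDiff ℝ ∞ η ∧ HasCompactSupport η ∧ tsupport η ⊆ closedBall 0 1 ∧
      ∀ T : E → ℝ, IsQuadraticPolynomial T → ∀ s, mollify η s T = T := by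
  let b : ContDiffBump (0 : E) := ⟨1 / 4, 1 / 2, by norm_num, by norm_num⟩
  let ρ : E → ℝ := b.normed volume
  have hρ : ContDiff ℝ ∞ ρ := b.contDiff_normed
  have hρc : HasCompactSupport ρ := b.hasCompactSupport_normed
  have hρs : ∀ y, 1 / 2 ≤ ‖y‖ → ρ y = 0 := by
    intro y hy
    by_contra h
    have : y ∈ Function.support ρ := h
    rw [b.support_normed_eq] at this
    simp [b] at this
    linarith
  have hρe : ∀ y, ρ (-y) = ρ y := b.normed_neg
  have hρ1 : ∫ y, ρ y = 1 := b.integral_normed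
  set c : ℝ := (2 ^ Module.finrank ℝ E)⁻¹ with hc
  let η : E → ℝ := fun y => (4 * ρ y - c * ρ ((2 : ℝ)⁻¹ • y)) / 3
  have hηd : ContDiff ℝ ∞ η := by
    have : ContDiff ℝ ∞ fun y => ρ ((2 : ℝ)⁻¹ • y) := hρ.comp (contDiff_const_smul _)
    fun_prop
  have hη0 : ∀ y, 1 ≤ ‖y‖ → η y = 0 := by
    intro y hy
    have h1 := hρs y (by linarith)
    have h2 := hρs ((2 : ℝ)⁻¹ • y) (by rw [norm_smul]; norm_num; linarith)
    simp [η, h1, h2]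
  have hsub : tsupport η ⊆ closedBall 0 1 := by
    refine closure_minimal (fun y hy => ?_) isClosed_closedBall
    by_contra h
    exact hy (hη0 y (by simpa using (not_le.1 (by simpa using h)).le))
  have hηc : HasCompactSupport η := (isCompact_closedBall 0 1).of_isClosed_subset
    (isClosed_tsupport η) hsub
  have hηe : ∀ y, η (-y) = η y := by intro y; simp [η, hρe, smul_neg]
  have key : ∀ f : E → ℝ, Continuous f → ∀ r : ℝ, (∀ y, f ((2 : ℝ) • y) = r * f y) →
      ∫ y, η y * f y = (4 - r) / 3 * ∫ y, ρ y * f y := by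
    intro f hf r hr
    have h2 : ∫ y, ρ ((2 : ℝ)⁻¹ • y) * f y = 2 ^ Module.finrank ℝ E * (r * ∫ y, ρ y * f y) := by
      have := Measure.integral_comp_inv_smul_of_nonneg (volume : Measure E)
        (fun y => ρ y * f ((2 : ℝ) • y)) (R := 2) (by norm_num)
      simp only [smul_smul, mul_inv_cancel₀ (two_ne_zero' ℝ), one_smul, hr] at this
      simp_rw [this, smul_eq_mul, mul_left_comm (ρ _) r, integral_const_mul]
    have i1 : Integrable fun y => ρ y * f y :=
      integrable_mul_of_hasCompactSupport hρ.continuous hρc hf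
    have i2 : Integrable fun y => ρ ((2 : ℝ)⁻¹ • y) * f y :=
      integrable_mul_of_hasCompactSupport (hρ.continuous.comp (by fun_prop))
        (hρc.comp_smul (by norm_num)) hf
    have : ∀ y, η y * f y = (4 / 3) * (ρ y * f y) - (c / 3) * (ρ ((2 : ℝ)⁻¹ • y) * f y) := by
      intro y; simp only [η]; ring
    simp_rw [this]
    rw [integral_sub (i1.const_mul _) (i2.const_mul _), integral_const_mul, integral_const_mul, h2,
      hc]
    field_simp
  refine ⟨η, hηd, hηc, hsub, ?_⟩
  rintro T ⟨a, L, Q, rfl⟩ s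
  ext x
  have m0 : ∫ y, η y = 1 := by
    have := key (fun _ => 1) continuous_const 1 (by simp)
    simp only [mul_one, hρ1] at this
    rw [this]; norm_num
  have m1 : ∀ M : E →L[ℝ] ℝ, ∫ y, η y * M y = 0 := fun M =>
    integral_eq_zero_of_odd fun y => by simp [hηe]
  have m2 : ∫ y, η y * Q y y = 0 := by
    rw [key (fun y => Q y y) (by fun_prop) 4 (by intro y; simp; ring)]; simp
  have hi : ∀ f : E → ℝ, Continuous f → Integrable fun y => η y * f y := fun f hf =>
    integrable_mul_of_hasCompactSupport hηd.continuous hηc hf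
  have i0 : Integrable η := hηd.continuous.integrable_of_hasCompactSupport hηc
  let M : E →L[ℝ] ℝ := L + Q x + Q.flip x
  have : ∀ y, η y * (a + L (x - s • y) + Q (x - s • y) (x - s • y)) =
      (a + L x + Q x x) * η y - s * (η y * M y) + s ^ 2 * (η y * Q y y) := by
    intro y; simp [M]; ring
  simp only [mollify, this]
  have i1 := (hi _ M.continuous).const_mul s
  have i2 := (hi (fun y => Q y y) (by fun_prop)).const_mul (s ^ 2)
  have i3 := i0.const_mul (a + L x + Q x x)
  have i4 : Integrable fun y => (a + L x + Q x x) * η y - s * (η y * M y) := i3.sub i1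
  rw [integral_add i4 i2, integral_sub i3 i1, integral_const_mul, integral_const_mul,
    integral_const_mul, m0, m1, m2]
  ring

end Mollify

section CkLimit

variable {E : Type} [NormedAddCommGroup E] [NormedSpace ℝ E]

omit [NormedAddCommGroup E] [NormedSpace ℝ E] in
theorem exists_tendstoUniformly_of_forall_norm_sub_le {F : Type} [NormedAddCommGroup F]
    [CompleteSpace F] {f : ℕ → E → F}
    (hf : ∀ ε > 0, ∃ N, ∀ m ≥ N, ∀ x, ‖f m x - f N x‖ ≤ ε) :
    ∃ g : E → F, TendstoUniformly f g atTop := by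
  have hc : ∀ x, CauchySeq fun n => f n x := by
    intro x
    refine Metric.cauchySeq_iff'.2 fun ε hε => ?_
    obtain ⟨N, hN⟩ := hf (ε / 2) (by positivity)
    exact ⟨N, fun n hn => by rw [dist_eq_norm]; linarith [hN n hn x]⟩
  choose g hg using fun x => cauchySeq_tendsto_of_complete (hc x)
  refine ⟨g, Metric.tendstoUniformly_iff.2 fun ε hε => ?_⟩
  obtain ⟨N, hN⟩ := hf (ε / 3) (by positivity)
  filter_upwards [eventually_ge_atTop N] with n hn x
  have h1 : ‖g x - f N x‖ ≤ ε / 3 :=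
    le_of_tendsto ((hg x).sub_const _).norm ((eventually_ge_atTop N).mono fun m hm => hN m hm x)
  rw [dist_eq_norm]
  have h2 := norm_sub_le (g x - f N x) (f n x - f N x)
  rw [sub_sub_sub_cancel_right] at h2
  linarith [hN n hn x]

/-- A sequence which is uniformly Cauchy together with its first `n` derivatives has a
`C^n` limit. -/
theorem exists_contDiff_limit (n : ℕ) :
    ∀ {F : Type} [NormedAddCommGroup F] [NormedSpace ℝ F] [CompleteSpace F] {f : ℕ → E → F},
      (∀ k, ContDiff ℝ n (f k)) →
      (∀ ε > 0, ∃ N, ∀ m ≥ N, ∀ x, ∀ j ≤ n, ‖iteratedFDeriv ℝ j (f m - f N) x‖ ≤ ε) →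
      ∃ g : E → F, ContDiff ℝ n g ∧ ∀ x, ∀ j ≤ n,
        Tendsto (fun k => iteratedFDeriv ℝ j (f k) x) atTop (𝓝 (iteratedFDeriv ℝ j g x)) := by
  have zeroth : ∀ {F : Type} [NormedAddCommGroup F] [NormedSpace ℝ F] {f : ℕ → E → F} {g : E → F}
      {x : E}, Tendsto (fun k => f k x) atTop (𝓝 (g x)) →
      Tendsto (fun k => iteratedFDeriv ℝ 0 (f k) x) atTop (𝓝 (iteratedFDeriv ℝ 0 g x)) := by
    intro F _ _ f g x h
    simp only [iteratedFDeriv_zero_eq_comp, Function.comp_apply]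
    exact ((continuousMultilinearCurryFin0 ℝ E F).symm.continuous.tendsto _).comp h
  induction n with
  | zero =>
    intro F _ _ _ f hf hC
    obtain ⟨g, hg⟩ := exists_tendstoUniformly_of_forall_norm_sub_le (f := f) fun ε hε => by
      obtain ⟨N, hN⟩ := hC ε hε
      exact ⟨N, fun m hm x => by simpa using hN m hm x 0 le_rfl⟩
    refine ⟨g, ?_, fun x j hj => ?_⟩
    · rw [Nat.cast_zero, contDiff_zero]
      exact hg.continuous (Frequently.of_forall fun k => (hf k).continuous)
    · obtain rfl := Nat.le_zero.1 hj
      exact zeroth (hg.tendsto_at x)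
  | succ n ih =>
    intro F _ _ _ f hf hC
    have hd : ∀ k, Differentiable ℝ (f k) := fun k => (hf k).differentiable (by simp)
    have hC' : ∀ ε > 0, ∃ N, ∀ m ≥ N, ∀ x, ∀ j ≤ n,
        ‖iteratedFDeriv ℝ j (fderiv ℝ (f m) - fderiv ℝ (f N)) x‖ ≤ ε := by
      intro ε hε
      obtain ⟨N, hN⟩ := hC ε hε
      refine ⟨N, fun m hm x j hj => ?_⟩
      have : fderiv ℝ (f m) - fderiv ℝ (f N) = fderiv ℝ (f m - f N) := by
        ext1 y
        exact (fderiv_sub (hd m y) (hd N y)).symm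
      rw [this, norm_iteratedFDeriv_fderiv]
      exact hN m hm x _ (by omega)
    obtain ⟨g', hg', ht⟩ := ih (f := fun k => fderiv ℝ (f k))
      (fun k => (hf k).fderiv_right (by simp)) hC'
    obtain ⟨g, hg⟩ := exists_tendstoUniformly_of_forall_norm_sub_le (f := f) fun ε hε => by
      obtain ⟨N, hN⟩ := hC ε hε
      exact ⟨N, fun m hm x => by simpa using hN m hm x 0 (by omega)⟩
    obtain ⟨g₁, hg₁⟩ := exists_tendstoUniformly_of_forall_norm_sub_le (f := fun k => fderiv ℝ (f k))
      fun ε hε => by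
        obtain ⟨N, hN⟩ := hC' ε hε
        exact ⟨N, fun m hm x => by simpa using hN m hm x 0 (by omega)⟩
    have hgg : g₁ = g' := by
      ext1 x
      have h := ht x 0 (by omega)
      have h2 := ((continuousMultilinearCurryFin0 ℝ E (E →L[ℝ] F)).continuous.tendsto _).comp h
      simp only [iteratedFDeriv_zero_eq_comp, Function.comp_def,
        LinearIsometryEquiv.apply_symm_apply] at h2
      exact tendsto_nhds_unique (hg₁.tendsto_at x) h2
    subst hgg
    have hder : ∀ x, HasFDerivAt g (g₁ x) x := fun x =>
      hasFDerivAt_of_tendstoUniformly hg₁ (fun k x => (hd k x).hasFDerivAt)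
        (fun x => hg.tendsto_at x) x
    refine ⟨g, ?_, fun x j hj => ?_⟩
    · rw [Nat.cast_succ, contDiff_succ_iff_hasFDerivAt]
      exact ⟨g₁, hg', hder⟩
    · rcases j with _ | j
      · exact zeroth (hg.tendsto_at x)
      · simp only [iteratedFDeriv_succ_eq_comp_right, Function.comp_apply]
        have : fderiv ℝ g = g₁ := funext fun x => (hder x).fderiv
        rw [this]
        exact (LinearIsometryEquiv.continuous _).continuousAt.tendsto.comp (ht x j (by omega))

end CkLimit

section Whitney

variable {E : Type} [NormedAddCommGroup E] [InnerProductSpace ℝ E]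

theorem norm_iteratedFDeriv_mul_le_of_scale {χ u : E → ℝ} (hχ : ContDiff ℝ 2 χ)
    (hu : ContDiff ℝ 2 u) {x : E} {C b s : ℝ} (hC : 0 ≤ C) (hb : 0 ≤ b) (hs : 0 < s)
    (h₁ : ∀ j ≤ 2, ‖iteratedFDeriv ℝ j χ x‖ ≤ C / s ^ j)
    (h₂ : ∀ j ≤ 2, ‖iteratedFDeriv ℝ j u x‖ ≤ b / s ^ j) {j : ℕ} (hj : j ≤ 2) :
    ‖iteratedFDeriv ℝ j (fun y => χ y * u y) x‖ ≤ 4 * C * b / s ^ j := by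
  calc ‖iteratedFDeriv ℝ j (fun y => χ y * u y) x‖
      ≤ ∑ i ∈ Finset.range (j + 1), (j.choose i : ℝ) * ‖iteratedFDeriv ℝ i χ x‖ *
          ‖iteratedFDeriv ℝ (j - i) u x‖ :=
        norm_iteratedFDeriv_mul_le hχ hu x (by exact_mod_cast hj)
    _ ≤ ∑ i ∈ Finset.range (j + 1), (j.choose i : ℝ) * (C * b / s ^ j) := by
        refine Finset.sum_le_sum fun i hi => ?_
        have hi' : i ≤ j := by simpa [Nat.lt_succ_iff] using hi
        calc (j.choose i : ℝ) * ‖iteratedFDeriv ℝ i χ x‖ * ‖iteratedFDeriv ℝ (j - i) u x‖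
            ≤ (j.choose i : ℝ) * (C / s ^ i) * (b / s ^ (j - i)) := by
              gcongr
              · exact h₁ i (by omega)
              · exact h₂ _ (by omega)
          _ = (j.choose i : ℝ) * (C * b / (s ^ i * s ^ (j - i))) := by ring
          _ = _ := by rw [← pow_add, Nat.add_sub_cancel' hi']
    _ = 2 ^ j * (C * b / s ^ j) := by
        rw [← Finset.sum_mul]
        congr 1
        exact_mod_cast Nat.sum_range_choose j
    _ ≤ 2 ^ 2 * (C * b / s ^ j) := by
        gcongr
        norm_num
    _ = _ := by ring

variable [FiniteDimensional ℝ E] [MeasurableSpace E] [BorelSpace E]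

/-- Smooth cutoffs at scale `s` around `P`. -/
theorem exists_cutoff (P : Set E) :
    ∃ C : ℝ, 0 ≤ C ∧ ∀ s : ℝ, 0 < s → ∃ χ : E → ℝ, ContDiff ℝ 2 χ ∧
      (∀ x, infDist x P < s → χ x = 1) ∧ (∀ x, 7 / 4 * s ≤ infDist x P → χ x = 0) ∧
      ∀ x, ∀ j ≤ 2, ‖iteratedFDeriv ℝ j χ x‖ ≤ C / s ^ j := by
  obtain ⟨η, hη, hc, hsupp, hT⟩ := exists_kernel_reproducing_quadratic (E := E)
  choose c hc0 hcb using norm_iteratedFDeriv_mollify_le hη hc hsupp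
  have h4 : ∀ j ≤ 2, (4 : ℝ) ^ j ≤ 16 := by
    intro j hj
    interval_cases j <;> norm_num
  refine ⟨16 * (c 0 + c 1 + c 2), by linarith [hc0 0, hc0 1, hc0 2], fun s hs => ?_⟩
  let θ : E → ℝ := fun w => max 0 (min 1 (6 - 4 * infDist w P / s))
  have hθc : Continuous θ := by
    have := continuous_infDist_pt P
    fun_prop
  have hθ : ∀ w, |θ w| ≤ 1 := by
    intro w
    rw [abs_of_nonneg (le_max_left _ _)]
    exact max_le zero_le_one (min_le_left _ _)
  have hs4 : 0 < s / 4 := by positivity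
  have hbd : ∀ (h : E → ℝ) (x : E) (B : ℝ), Continuous h →
      (∀ y ∈ closedBall x (s / 4), |h y| ≤ B) → |mollify η (s / 4) h x| ≤ c 0 * B := by
    intro h x B hh hB
    simpa using hcb 0 h x B (s / 4) hh hs4 hB
  have hdist : ∀ x y, y ∈ closedBall x (s / 4) → |infDist y P - infDist x P| ≤ s / 4 := by
    intro x y hy
    have h1 := infDist_le_infDist_add_dist (s := P) (x := x) (y := y)
    have h2 := infDist_le_infDist_add_dist (s := P) (x := y) (y := x)
    have h3 : dist y x ≤ s / 4 := hy
    rw [dist_comm] at h1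
    exact abs_le.2 ⟨by linarith, by linarith⟩
  refine ⟨mollify η (s / 4) θ, (contDiff_mollify hη hc hs4.ne' hθc).of_le (WithTop.coe_le_coe.2 le_top),
    fun x hx => ?_, fun x hx => ?_, fun x j hj => ?_⟩
  · have h1 := hT (fun _ => 1) ⟨1, 0, 0, by simp⟩ (s / 4)
    have h2 := hbd (θ - fun _ => 1) x 0 (hθc.sub continuous_const) fun y hy => by
      have h := abs_le.1 (hdist x y hy)
      have : 4 * infDist y P / s ≤ 5 := by
        rw [div_le_iff₀ hs]; linarith [h.2]
      have : θ y = 1 := by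
        simp only [θ]
        rw [min_eq_left (by linarith), max_eq_right zero_le_one]
      simp [this]
    rw [mollify_sub hη.continuous hc _ hθc continuous_const, h1] at h2
    simp only [Pi.sub_apply, mul_zero] at h2
    linarith [abs_nonpos_iff.1 h2]
  · have h2 := hbd θ x 0 hθc fun y hy => by
      have h := abs_le.1 (hdist x y hy)
      have : 6 ≤ 4 * infDist y P / s := by
        rw [le_div_iff₀ hs]; linarith [h.1]
      have : θ y = 0 := by
        simp only [θ]
        exact max_eq_left ((min_le_right _ _).trans (by linarith))
      simp [this]
    simpa using h2
  · have h1 := hcb j θ x 1 (s / 4) hθc hs4 fun y _ => hθ y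
    refine h1.trans ?_
    have h5 : c j ≤ c 0 + c 1 + c 2 := by
      have := hc0 0; have := hc0 1; have := hc0 2
      interval_cases j <;> linarith
    have h6 : c j * 4 ^ j ≤ 16 * (c 0 + c 1 + c 2) := by
      have := mul_le_mul h5 (h4 j hj) (by positivity) ((hc0 j).trans h5)
      linarith
    rw [div_pow, mul_one, div_div_eq_mul_div]
    exact div_le_div_of_nonneg_right h6 (by positivity)

theorem exists_contDiff_two_eq_on {P : Set E} (hP : IsClosed P) (hne : P.Nonempty) {g : E → ℝ}
    (hg : Continuous g) {T : E → E → ℝ} (hT : ∀ p ∈ P, IsQuadraticPolynomial (T p))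
    (hgT : ∀ ε > 0, ∃ δ > 0, ∀ p ∈ P, ∀ w, ‖w - p‖ < δ → |g w - T p w| ≤ ε * ‖w - p‖ ^ 2) :
    ∃ f : E → ℝ, ContDiff ℝ 2 f ∧
      ∀ p ∈ P, ∀ j ≤ 2, iteratedFDeriv ℝ j f p = iteratedFDeriv ℝ j (T p) p := by
  obtain ⟨η, hη, hc, hsupp, hηT⟩ := exists_kernel_reproducing_quadratic (E := E)
  choose c hc0 hcb using norm_iteratedFDeriv_mollify_le hη hc hsupp
  obtain ⟨C, hC0, hχ⟩ := exists_cutoff P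
  let s : ℕ → ℝ := fun k => (2⁻¹ : ℝ) ^ k
  have hs : ∀ k, 0 < s k := fun k => by positivity
  have hs1 : ∀ k, s k ≤ 1 := fun k => pow_le_one₀ (by norm_num) (by norm_num)
  have hsucc : ∀ k, s (k + 1) = s k / 2 := fun k => by simp only [s, pow_succ]; ring
  have hanti : Antitone s := antitone_nat_of_succ_le fun k => by rw [hsucc]; linarith [hs k]
  have hs0 : Tendsto s atTop (𝓝 0) := tendsto_pow_atTop_nhds_zero_of_lt_one (by norm_num) (by norm_num)
  choose χ hχd hχ1 hχ0 hχb using fun k => hχ (s k) (hs k)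
  let f : ℕ → E → ℝ := fun k => mollify η (s k) g
  have hfd : ∀ k, ContDiff ℝ 2 (f k) := fun k =>
    (contDiff_mollify hη hc (hs k).ne' hg).of_le (WithTop.coe_le_coe.2 le_top)
  choose π hπP hπ using fun x => hP.exists_infDist_eq_dist hne x
  have hTd : ∀ x, ContDiff ℝ 2 (T (π x)) := fun x => (hT _ (hπP x)).contDiff
  have hπp : ∀ p ∈ P, π p = p := fun p hp => by
    have := hπ p
    rw [infDist_zero_of_mem hp] at this
    exact (dist_eq_zero.1 this.symm).symm
  have E1 : ∀ ε > 0, ∃ N, ∀ k ≥ N, ∀ x, infDist x P ≤ 4 * s k → ∀ j ≤ 2,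
      ‖iteratedFDeriv ℝ j (f k - T (π x)) x‖ ≤ ε * s k ^ 2 / s k ^ j := by
    intro ε hε
    set c' := c 0 + c 1 + c 2 + 1 with hc'
    have hc'0 : 0 < c' := by linarith [hc0 0, hc0 1, hc0 2]
    obtain ⟨δ, hδ, H⟩ := hgT (ε / (25 * c')) (by positivity)
    obtain ⟨N, hN⟩ := eventually_atTop.1 ((tendsto_order.1 hs0).2 (δ / 5) (by positivity))
    refine ⟨N, fun k hk x hx j hj => ?_⟩
    have hTc := (hTd x).continuous
    have h1 := hcb j (g - T (π x)) x (ε / c' * s k ^ 2) (s k) (hg.sub hTc) (hs k) fun y hy => by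
      have h2 : ‖y - π x‖ ≤ 5 * s k := by
        have := dist_triangle y x (π x)
        rw [← hπ x, dist_eq_norm] at this
        have h3 : dist y x ≤ s k := hy
        linarith
      have h4 := H _ (hπP x) y (by linarith [hN k hk])
      refine h4.trans ?_
      calc ε / (25 * c') * ‖y - π x‖ ^ 2 ≤ ε / (25 * c') * (5 * s k) ^ 2 := by gcongr
        _ = _ := by field_simp; ring
    rw [mollify_sub hη.continuous hc _ hg hTc, hηT _ (hT _ (hπP x))] at h1
    refine h1.trans ?_
    have := hs k
    refine div_le_div_of_nonneg_right ?_ (by positivity)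
    have h5 : c j ≤ c' := by
      have := hc0 0; have := hc0 1; have := hc0 2
      interval_cases j <;> linarith
    calc c j * (ε / c' * s k ^ 2) ≤ c' * (ε / c' * s k ^ 2) := by gcongr
      _ = ε * s k ^ 2 := by field_simp
  have hd : ∀ {u : E → ℝ} (x : E) {j : ℕ}, ContDiff ℝ 2 u → j ≤ 2 →
      ContDiffAt ℝ j (u - T (π x)) x := fun x j hu hj =>
    ((hu.sub (hTd x)).of_le (by exact_mod_cast hj)).contDiffAt
  let F : ℕ → E → ℝ := fun k => Nat.rec (f 0) (fun k Fk x => Fk x + χ k x * (f (k + 1) x - f k x)) k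
  have hF0 : F 0 = f 0 := rfl
  have hFs : ∀ k, F (k + 1) = fun x => F k x + χ k x * (f (k + 1) x - f k x) := fun k => rfl
  have hFd : ∀ k, ContDiff ℝ 2 (F k) := by
    intro k
    induction k with
    | zero => exact hfd 0
    | succ k ih =>
      rw [hFs]
      exact ih.add ((hχd k).mul ((hfd _).sub (hfd _)))
  have hopen : ∀ r, IsOpen {x | infDist x P < r} := fun r =>
    isOpen_lt (continuous_infDist_pt P) continuous_const
  have L1 : ∀ k x, infDist x P < 2 * s k → F k x = f k x := by
    intro k
    induction k with
    | zero => intro x _; rfl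
    | succ k ih =>
      intro x hx
      rw [hsucc] at hx
      simp only [hFs]
      rw [ih x (by linarith [hs k]), hχ1 k x (by linarith)]
      ring
  have L1' : ∀ k x, infDist x P < 2 * s k → F k =ᶠ[𝓝 x] f k := fun k x hx =>
    Filter.mem_of_superset ((hopen (2 * s k)).mem_nhds hx) (L1 k)
  have L2 : ∀ k x, 2 * s k ≤ infDist x P → F (k + 1) =ᶠ[𝓝 x] F k := by
    intro k x hx
    have : {y | 7 / 4 * s k < infDist y P} ∈ 𝓝 x :=
      (isOpen_lt continuous_const (continuous_infDist_pt P)).mem_nhds (by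
        show 7 / 4 * s k < infDist x P
        linarith [hs k])
    filter_upwards [this] with y hy
    simp only [hFs]
    rw [hχ0 k y (le_of_lt hy)]
    ring
  have L2' : ∀ N m, N ≤ m → ∀ x, 2 * s N ≤ infDist x P → F m =ᶠ[𝓝 x] F N := by
    intro N m hm x hx
    induction m, hm using Nat.le_induction with
    | base => exact EventuallyEq.rfl
    | succ m hm ih => exact (L2 m x (by linarith [hanti hm])).trans ih
  have hcongr : ∀ {u v : E → ℝ} {x : E} (j : ℕ), u =ᶠ[𝓝 x] v →
      iteratedFDeriv ℝ j u x = iteratedFDeriv ℝ j v x := fun j h => (h.iteratedFDeriv ℝ j).eq_of_nhds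
  have hle : ∀ {ε : ℝ} (k : ℕ) {j : ℕ}, 0 ≤ ε → j ≤ 2 → ε * s k ^ 2 / s k ^ j ≤ ε := by
    intro ε k j hε hj
    rw [div_le_iff₀ (pow_pos (hs k) j)]
    have := pow_le_pow_of_le_one (hs k).le (hs1 k) hj
    gcongr
  have E3 : ∀ ε > 0, ∃ N, ∀ k ≥ N, ∀ x, infDist x P < 2 * s k → ∀ j ≤ 2,
      ‖iteratedFDeriv ℝ j (F (k + 1) - T (π x)) x‖ ≤ ε := by
    intro ε hε
    set ε' := ε / (1 + 8 * C) with hε'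
    have hε'0 : 0 < ε' := by positivity
    obtain ⟨N, hN⟩ := E1 ε' hε'0
    refine ⟨N, fun k hk x hx j hj => ?_⟩
    have hsk := hs k
    have b1 : ∀ j ≤ 2, ‖iteratedFDeriv ℝ j (f k - T (π x)) x‖ ≤ ε' * s k ^ 2 / s k ^ j :=
      hN k hk x (by linarith)
    have b2 : ∀ j ≤ 2, ‖iteratedFDeriv ℝ j (f (k + 1) - T (π x)) x‖ ≤ ε' * s k ^ 2 / s k ^ j := by
      intro j hj
      refine (hN (k + 1) (by omega) x (by rw [hsucc]; linarith) j hj).trans ?_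
      rw [hsucc]
      interval_cases j
      · simp only [pow_zero, div_one]; gcongr; linarith
      · simp only [pow_one]
        rw [div_le_div_iff₀ (by positivity) (by positivity)]
        have : 0 < ε' * s k ^ 3 := by positivity
        nlinarith
      · rw [div_le_div_iff₀ (by positivity) (by positivity)]
        exact le_of_eq (by ring)
    have b3 : ∀ j ≤ 2, ‖iteratedFDeriv ℝ j (fun y => f (k + 1) y - f k y) x‖ ≤
        2 * (ε' * s k ^ 2) / s k ^ j := by
      intro j hj
      have : (fun y => f (k + 1) y - f k y) = (f (k + 1) - T (π x)) - (f k - T (π x)) := by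
        ext y; simp
      rw [this, iteratedFDeriv_sub_apply (hd x (hfd (k + 1)) hj) (hd x (hfd k) hj)]
      refine (norm_sub_le _ _).trans ?_
      rw [mul_div_assoc, two_mul]
      exact add_le_add (b2 j hj) (b1 j hj)
    have b4 := norm_iteratedFDeriv_mul_le_of_scale (hχd k) ((hfd (k + 1)).sub (hfd k)) hC0
      (by positivity) hsk (hχb k x) b3 hj
    have heq : F (k + 1) - T (π x) =ᶠ[𝓝 x]
        (f k - T (π x)) + fun y => χ k y * (f (k + 1) y - f k y) := by
      filter_upwards [L1' k x hx] with y hy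
      simp only [Pi.sub_apply, Pi.add_apply, hFs, hy]
      ring
    have hj' : (j : ℕ∞ω) ≤ 2 := by exact_mod_cast hj
    rw [hcongr j heq, iteratedFDeriv_add_apply (hd x (hfd k) hj)
      (((hχd k).mul ((hfd (k + 1)).sub (hfd k))).of_le hj').contDiffAt]
    calc _ ≤ ε' * s k ^ 2 / s k ^ j + 4 * C * (2 * (ε' * s k ^ 2)) / s k ^ j :=
          (norm_add_le _ _).trans (add_le_add (b1 j hj) b4)
      _ = ε * s k ^ 2 / s k ^ j := by rw [hε']; field_simp; ring
      _ ≤ ε := hle k hε.le hj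
  have E4 : ∀ ε > 0, ∃ N, ∀ m ≥ N, ∀ x, infDist x P < 2 * s N → ∀ j ≤ 2,
      ‖iteratedFDeriv ℝ j (F m - T (π x)) x‖ ≤ ε := by
    intro ε hε
    obtain ⟨N₁, hN₁⟩ := E1 ε hε
    obtain ⟨N₂, hN₂⟩ := E3 ε hε
    refine ⟨max N₁ N₂, fun m hm x hx j hj => ?_⟩
    induction m, hm using Nat.le_induction with
    | base =>
      set N := max N₁ N₂
      have : F N - T (π x) =ᶠ[𝓝 x] f N - T (π x) := (L1' N x hx).sub EventuallyEq.rfl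
      rw [hcongr j this]
      exact (hN₁ N (le_max_left _ _) x (by linarith [hs N]) j hj).trans (hle N hε.le hj)
    | succ m hm ih =>
      rcases lt_or_ge (infDist x P) (2 * s m) with h | h
      · exact hN₂ m ((le_max_right _ _).trans hm) x h j hj
      · rw [hcongr j ((L2 m x h).sub EventuallyEq.rfl)]
        exact ih
  obtain ⟨G, hG, hlim⟩ := exists_contDiff_limit 2 (f := F) hFd fun ε hε => by
    obtain ⟨N, hN⟩ := E4 (ε / 2) (by positivity)
    refine ⟨N, fun m hm x j hj => ?_⟩
    rcases lt_or_ge (infDist x P) (2 * s N) with h | h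
    · have : F m - F N = (F m - T (π x)) - (F N - T (π x)) := by simp
      rw [this, iteratedFDeriv_sub_apply (hd x (hFd m) hj) (hd x (hFd N) hj)]
      refine (norm_sub_le _ _).trans ?_
      linarith [hN m hm x h j hj, hN N le_rfl x h j hj]
    · have : F m - F N =ᶠ[𝓝 x] fun _ => (0 : ℝ) := by
        filter_upwards [L2' N m hm x h] with y hy
        simp [hy]
      rw [hcongr j this]
      have : iteratedFDeriv ℝ j (fun _ : E => (0 : ℝ)) = 0 := iteratedFDeriv_fun_zero
      rw [this]
      simpa using hε.le
  refine ⟨G, hG, fun p hp j hj => ?_⟩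
  have hj' : (j : ℕ∞ω) ≤ 2 := by exact_mod_cast hj
  refine tendsto_nhds_unique (hlim p j hj) ?_
  rw [Metric.tendsto_atTop]
  intro ε hε
  obtain ⟨N, hN⟩ := E4 (ε / 2) (by positivity)
  refine ⟨N, fun m hm => ?_⟩
  have h := hN m hm p (by rw [infDist_zero_of_mem hp]; linarith [hs N]) j hj
  rw [iteratedFDeriv_sub_apply ((hFd m).of_le hj').contDiffAt ((hTd p).of_le hj').contDiffAt,
    hπp p hp] at h
  rw [dist_eq_norm]
  linarith

end Whitney

section Moreau

variable {E : Type} [NormedAddCommGroup E] [InnerProductSpace ℝ E]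

/-- `z` is a subgradient of `g` at `η`. -/
def IsSubgradient (g : E → ℝ) (η z : E) : Prop :=
  ∀ η', g η + ⟪z, η' - η⟫ ≤ g η'

theorem IsSubgradient.inner_nonneg {g : E → ℝ} {p p' z z' : E} (h : IsSubgradient g p z)
    (h' : IsSubgradient g p' z') : 0 ≤ ⟪z - z', p - p'⟫ := by
  have h1 := h p'
  have h2 := h' p
  simp only [inner_sub_left, inner_sub_right] at *
  linarith

theorem isSubgradient_of_forall_le {g : E → ℝ} (hg : ConvexOn ℝ univ g) {y p : E}
    (hp : ∀ η, g p + ‖y - p‖ ^ 2 / 2 ≤ g η + ‖y - η‖ ^ 2 / 2) : IsSubgradient g p (y - p) := by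
  intro η
  have key : ∀ t : ℝ, 0 < t → t ≤ 1 → g p + ⟪y - p, η - p⟫ ≤ g η + t * ‖η - p‖ ^ 2 / 2 := by
    intro t ht ht1
    have h1 := hg.2 (mem_univ p) (mem_univ η) (sub_nonneg.2 ht1) ht.le (by ring)
    have h2 := hp ((1 - t) • p + t • η)
    have h3 : y - ((1 - t) • p + t • η) = (y - p) - t • (η - p) := by module
    rw [h3, norm_sub_sq_real (y - p) (t • (η - p)), inner_smul_right, norm_smul, Real.norm_eq_abs, mul_pow, sq_abs] at h2
    simp only [smul_eq_mul] at h1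
    have h4 : t * (g p + ⟪y - p, η - p⟫) ≤ t * (g η + t * ‖η - p‖ ^ 2 / 2) := by nlinarith
    exact le_of_mul_le_mul_left h4 ht
  have hlim : Tendsto (fun t : ℝ => g η + t * ‖η - p‖ ^ 2 / 2) (𝓝[>] 0) (𝓝 (g η)) := by
    have : Continuous fun t : ℝ => g η + t * ‖η - p‖ ^ 2 / 2 := by fun_prop
    simpa using (this.tendsto 0).mono_left nhdsWithin_le_nhds
  refine ge_of_tendsto hlim ?_
  filter_upwards [Ioc_mem_nhdsGT (zero_lt_one' ℝ)] with t ht using key t ht.1 ht.2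

theorem exists_isSubgradient_sub [FiniteDimensional ℝ E] {g : E → ℝ} (hg : ConvexOn ℝ univ g)
    (hc : Continuous g) {η₀ z₀ : E} (h₀ : IsSubgradient g η₀ z₀) (y : E) :
    ∃ p, IsSubgradient g p (y - p) := by
  have hlb : ∀ η, g η₀ - ‖z₀‖ * ‖y - η₀‖ - ‖z₀‖ ^ 2 + ‖y - η‖ ^ 2 / 4 ≤ g η + ‖y - η‖ ^ 2 / 2 := by
    intro η
    have h1 := h₀ η
    have h2 := neg_le_of_abs_le (abs_real_inner_le_norm z₀ (η - η₀))
    have h3 : ‖η - η₀‖ ≤ ‖y - η₀‖ + ‖y - η‖ := by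
      rw [norm_sub_rev y η, add_comm]
      exact norm_sub_le_norm_sub_add_norm_sub _ _ _
    have h4 := mul_le_mul_of_nonneg_left h3 (norm_nonneg z₀)
    nlinarith [sq_nonneg (‖z₀‖ - ‖y - η‖ / 2)]
  have ht : Tendsto (fun η => g η + ‖y - η‖ ^ 2 / 2) (cocompact E) atTop := by
    refine tendsto_atTop_mono hlb (tendsto_atTop_add_const_left _ _ ?_)
    refine Tendsto.atTop_div_const (by norm_num) ((tendsto_pow_atTop two_ne_zero).comp ?_)
    refine tendsto_atTop_mono (fun η => ?_)
      (tendsto_atTop_add_const_left (cocompact E) (-‖y‖) (tendsto_norm_cocompact_atTop (E := E)))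
    have := norm_sub_norm_le η y
    rw [norm_sub_rev] at this
    linarith
  obtain ⟨p, hp⟩ := Continuous.exists_forall_le (by fun_prop) ht
  exact ⟨p, isSubgradient_of_forall_le hg hp⟩

theorem exists_moreau_envelope [FiniteDimensional ℝ E] {g : E → ℝ} (hg : ConvexOn ℝ univ g)
    (hc : Continuous g) {η₀ z₀ : E} (h₀ : IsSubgradient g η₀ z₀) :
    ∃ (R : E → E) (e : E → ℝ), (∀ y, IsSubgradient g (y - R y) (R y)) ∧ LipschitzWith 1 R ∧
      (∀ y, HasFDerivAt e (innerSL ℝ (R y)) y) ∧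
      (∀ y y', ‖R y - R y'‖ ^ 2 ≤ ⟪R y - R y', y - y'⟫) ∧
      (∀ y, e y = g (y - R y) + ‖R y‖ ^ 2 / 2) ∧ ∀ η z, IsSubgradient g η z → R (η + z) = z := by
  choose p hp using exists_isSubgradient_sub hg hc h₀
  have hmono : ∀ {q q' z z'}, IsSubgradient g q z → IsSubgradient g q' z' →
      ‖z - z'‖ ^ 2 ≤ ⟪z - z', (q + z) - (q' + z')⟫ := by
    intro q q' z z' h h'
    have := h.inner_nonneg h'
    rw [show (q + z) - (q' + z') = (q - q') + (z - z') by abel, inner_add_right,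
      real_inner_self_eq_norm_sq]
    linarith
  have hlip : ∀ {q q' z z'}, IsSubgradient g q z → IsSubgradient g q' z' →
      ‖z - z'‖ ≤ ‖(q + z) - (q' + z')‖ := by
    intro q q' z z' h h'
    have h1 := (hmono h h').trans (real_inner_le_norm _ _)
    rcases (norm_nonneg (z - z')).eq_or_lt with h2 | h2
    · rw [← h2]; positivity
    · rw [sq] at h1
      exact le_of_mul_le_mul_left h1 h2
  let R : E → E := fun y => y - p y
  have hR : ∀ y, IsSubgradient g (y - R y) (R y) := fun y => by simpa [R] using hp y
  have hm : ∀ y y', ‖R y - R y'‖ ^ 2 ≤ ⟪R y - R y', y - y'⟫ := fun y y' => by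
    simpa using hmono (hR y) (hR y')
  have hl : ∀ y y', ‖R y - R y'‖ ≤ ‖y - y'‖ := fun y y' => by simpa using hlip (hR y) (hR y')
  refine ⟨R, fun y => g (y - R y) + ‖R y‖ ^ 2 / 2, hR,
    LipschitzWith.of_dist_le_mul fun y y' => by simpa [dist_eq_norm] using hl y y', fun y => ?_, hm,
    fun _ => rfl, fun η z h => ?_⟩
  · rw [hasFDerivAt_iff_isLittleO]
    refine Asymptotics.IsBigO.trans_isLittleO (g := fun y' => ‖y' - y‖ ^ 2) ?_ ?_
    · refine Asymptotics.IsBigO.of_bound 1 (Eventually.of_forall fun y' => ?_)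
      have h1 := hR y (y' - R y')
      have h2 := hR y' (y - R y)
      have h3 := hm y' y
      have h4 : ⟪R y' - R y, y' - y⟫ ≤ ‖y' - y‖ ^ 2 := by
        refine (real_inner_le_norm _ _).trans ?_
        rw [sq]
        exact mul_le_mul_of_nonneg_right (hl y' y) (norm_nonneg _)
      rw [innerSL_apply_apply, one_mul, Real.norm_eq_abs, norm_pow, norm_norm, abs_le]
      rw [norm_sub_sq_real] at h3
      simp only [inner_sub_left, inner_sub_right, real_inner_self_eq_norm_sq] at *
      have h5 := sq_nonneg (‖R y - R y'‖)
      rw [norm_sub_sq_real] at h5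
      have h6 := real_inner_comm (R y) (R y')
      constructor <;> nlinarith
    · have : (fun y' : E => ‖y' - y‖ ^ 2) = (fun v : E => ‖v‖ ^ 2) ∘ fun y' => y' - y := rfl
      have h := (Asymptotics.isLittleO_norm_pow_id (E' := E) one_lt_two).comp_tendsto
        (k := fun y' => y' - y) (l' := 𝓝 y) (by
          have : Continuous fun y' : E => y' - y := by fun_prop
          simpa using this.tendsto y)
      exact h
  · have h1 := hlip (hR (η + z)) h
    simp only [sub_add_cancel, sub_self, norm_zero] at h1
    exact sub_eq_zero.1 (norm_le_zero_iff.1 h1)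

end Moreau

section Egorov

variable {E F : Type} [NormedAddCommGroup E] [NormedSpace ℝ E] [FiniteDimensional ℝ E]
  [MeasurableSpace E] [BorelSpace E] [NormedAddCommGroup F] [NormedSpace ℝ F]
  [FiniteDimensional ℝ F]

theorem measurableSet_fderiv_error_le {R : E → F} (hR : Continuous R) (δ ε : ℝ) :
    MeasurableSet {p | ∀ h : E, ‖h‖ < δ → ‖R (p + h) - R p - fderiv ℝ R p h‖ ≤ ε * ‖h‖} := by
  borelize F
  have h1 : ∀ h : E, MeasurableSet {p | ‖R (p + h) - R p - fderiv ℝ R p h‖ ≤ ε * ‖h‖} := by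
    intro h
    refine measurableSet_le ?_ measurable_const
    have h2 : Measurable fun p => R (p + h) - R p := by
      have : Continuous fun p => R (p + h) - R p := by fun_prop
      exact this.measurable
    exact (h2.sub (measurable_fderiv_apply_const ℝ R h)).norm
  have h3 : {p | ∀ h : E, ‖h‖ < δ → ‖R (p + h) - R p - fderiv ℝ R p h‖ ≤ ε * ‖h‖} =
      ⋂ i : ℕ, ⋂ _ : ‖TopologicalSpace.denseSeq E i‖ < δ,
        {p | ‖R (p + TopologicalSpace.denseSeq E i) - R p -
          fderiv ℝ R p (TopologicalSpace.denseSeq E i)‖ ≤ ε * ‖TopologicalSpace.denseSeq E i‖} := by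
    ext p
    simp only [mem_ofPred_eq, mem_iInter]
    refine ⟨fun H i hi => H _ hi, fun H h hh => ?_⟩
    have hcl : IsClosed {h : E | ‖R (p + h) - R p - fderiv ℝ R p h‖ ≤ ε * ‖h‖} :=
      isClosed_le (by fun_prop) (by fun_prop)
    have hmem : h ∈ closure (ball (0 : E) δ ∩ range (TopologicalSpace.denseSeq E)) :=
      (TopologicalSpace.denseRange_denseSeq E).open_subset_closure_inter isOpen_ball (by simpa using hh)
    refine closure_minimal ?_ hcl hmem
    rintro _ ⟨hx, i, rfl⟩
    exact H i (by simpa using hx)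
  rw [h3]
  exact MeasurableSet.iInter fun i => MeasurableSet.iInter fun _ => h1 _

theorem exists_isCompact_uniform_fderiv {μ : Measure E} [μ.IsAddHaarMeasure] {R : E → F}
    (hR : Continuous R) {D : Set E} (hD : MeasurableSet D) (hμ : μ D ≠ 0)
    (hd : ∀ x ∈ D, DifferentiableAt ℝ R x) :
    ∃ P ⊆ D, IsCompact P ∧ μ P ≠ 0 ∧ ∀ ε > 0, ∃ δ > 0, ∀ p ∈ P, ∀ w, ‖w - p‖ < δ →
      ‖R w - R p - fderiv ℝ R p (w - p)‖ ≤ ε * ‖w - p‖ := by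
  obtain ⟨K, hKD, hK, hK0⟩ := hD.exists_lt_isCompact (pos_iff_ne_zero.2 hμ)
  let A : ℕ → ℕ → Set E := fun j k => {p | ∀ h : E, ‖h‖ < 1 / ((k : ℝ) + 1) →
    ‖R (p + h) - R p - fderiv ℝ R p h‖ ≤ 1 / ((j : ℝ) + 1) * ‖h‖}
  have hAm : ∀ j k, MeasurableSet (A j k) := fun j k => measurableSet_fderiv_error_le hR _ _
  have hlim : ∀ j, Tendsto (fun k => μ (K \ A j k)) atTop (𝓝 0) := by
    intro j
    have hempty : ⋂ k, K \ A j k = ∅ := by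
      refine eq_empty_of_forall_notMem fun p hp => ?_
      rw [mem_iInter] at hp
      have h1 := (hasFDerivAt_iff_isLittleO_nhds_zero.1 (hd p (hKD (hp 0).1)).hasFDerivAt).def
        (c := 1 / ((j : ℝ) + 1)) (by positivity)
      obtain ⟨δ, hδ, H⟩ := Metric.eventually_nhds_iff.1 h1
      obtain ⟨k, hk⟩ := exists_nat_one_div_lt hδ
      refine (hp k).2 fun h hh => H ?_
      rw [dist_zero_right]
      exact hh.trans hk
    rw [← measure_empty (μ := μ), ← hempty]
    refine tendsto_measure_iInter_atTop (fun k => (hK.measurableSet.diff (hAm j k)).nullMeasurableSet)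
      ?_ ⟨0, ((measure_mono sdiff_subset).trans_lt hK.measure_lt_top).ne⟩
    intro k l hkl
    refine sdiff_subset_sdiff_right fun p hp h hh => hp h (hh.trans_le ?_)
    have : (k : ℝ) ≤ l := by exact_mod_cast hkl
    exact one_div_le_one_div_of_le (by positivity) (by linarith)
  obtain ⟨ε', hε'0, hε'⟩ := ENNReal.exists_pos_sum_of_countable' hK0.ne' ℕ
  have : ∀ j, ∃ k, μ (K \ A j k) < ε' j := fun j => ((tendsto_order.1 (hlim j)).2 _ (hε'0 j)).exists
  choose k hk using this
  have hP0m : MeasurableSet (K ∩ ⋂ j, A j (k j)) :=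
    hK.measurableSet.inter (MeasurableSet.iInter fun j => hAm j _)
  have hP0 : μ (K ∩ ⋂ j, A j (k j)) ≠ 0 := by
    intro h0
    have h1 : K ⊆ (K ∩ ⋂ j, A j (k j)) ∪ ⋃ j, K \ A j (k j) := by
      intro p hp
      by_cases h : p ∈ ⋂ j, A j (k j)
      · exact Or.inl ⟨hp, h⟩
      · rw [mem_iInter, not_forall] at h
        obtain ⟨j, hj⟩ := h
        exact Or.inr (mem_iUnion.2 ⟨j, hp, hj⟩)
    have h2 := (measure_mono h1).trans (measure_union_le (μ := μ) _ _)
    rw [h0, zero_add] at h2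
    have h3 := h2.trans ((measure_iUnion_le _).trans (ENNReal.tsum_le_tsum fun j => (hk j).le))
    exact absurd h3 (not_le.2 hε')
  obtain ⟨P, hPsub, hP, hPpos⟩ := hP0m.exists_lt_isCompact (pos_iff_ne_zero.2 hP0)
  refine ⟨P, fun p hp => hKD (hPsub hp).1, hP, hPpos.ne', fun ε hε => ?_⟩
  obtain ⟨j, hj⟩ := exists_nat_one_div_lt hε
  refine ⟨1 / ((k j : ℝ) + 1), by positivity, fun p hp w hw => ?_⟩
  have h1 := mem_iInter.1 (hPsub hp).2 j (w - p) hw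
  rw [add_sub_cancel] at h1
  exact h1.trans (by gcongr)

end Egorov

section Rademacher

variable {E : Type} [NormedAddCommGroup E] [InnerProductSpace ℝ E] [FiniteDimensional ℝ E]
  [MeasurableSpace E] [BorelSpace E]

theorem LipschitzWith.hausdorffMeasure_image_eq_zero {X Y : Type} [EMetricSpace X] [EMetricSpace Y]
    [MeasurableSpace X] [BorelSpace X] [MeasurableSpace Y] [BorelSpace Y] {C : ℝ≥0} {f : X → Y}
    (hf : LipschitzWith C f) {d : ℝ} (hd : 0 ≤ d) {s : Set X} (hs : μH[d] s = 0) :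
    μH[d] (f '' s) = 0 := by
  have := hf.hausdorffMeasure_image_le hd s
  rwa [hs, mul_zero, nonpos_iff_eq_zero] at this

theorem measure_inter_preimage_ne_zero_of_subset_image {μ : Measure E} [μ.IsAddHaarMeasure]
    (hμ : μ = μH[Module.finrank ℝ E]) {C : ℝ≥0} {R : E → E} (hR : LipschitzWith C R)
    {O S : Set E} (hS : S ⊆ R '' O) (hS0 : μ S ≠ 0) :
    μ (O ∩ R ⁻¹' S ∩ {x | DifferentiableAt ℝ R x ∧ (fderiv ℝ R x).det ≠ 0}) ≠ 0 := by
  intro h0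
  have hnull : ∀ s, μ s = 0 → μ (R '' s) = 0 := fun s hs => by
    rw [hμ] at hs ⊢
    exact hR.hausdorffMeasure_image_eq_zero (by positivity) hs
  have h1 : μ (R '' {x | ¬ DifferentiableAt ℝ R x}) = 0 := hnull _ (hR.ae_differentiableAt (μ := μ))
  have h2 : μ (R '' {x | DifferentiableAt ℝ R x ∧ (fderiv ℝ R x).det = 0}) = 0 :=
    addHaar_image_eq_zero_of_det_fderivWithin_eq_zero μ
      (fun x hx => hx.1.hasFDerivAt.hasFDerivWithinAt) fun x hx => hx.2
  refine hS0 (measure_mono_null ?_ (measure_union_null (hnull _ h0) (measure_union_null h1 h2)))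
  intro z hz
  obtain ⟨x, hx, rfl⟩ := hS hz
  by_cases hd : DifferentiableAt ℝ R x
  · by_cases hdet : (fderiv ℝ R x).det = 0
    · exact Or.inr (Or.inr ⟨x, ⟨hd, hdet⟩, rfl⟩)
    · exact Or.inl ⟨x, ⟨⟨hx, hz⟩, hd, hdet⟩, rfl⟩
  · exact Or.inr (Or.inl ⟨x, hd, rfl⟩)

theorem measurableSet_differentiableAt_and_det_ne_zero (R : E → E) :
    MeasurableSet {x | DifferentiableAt ℝ R x ∧ (fderiv ℝ R x).det ≠ 0} :=
  (measurableSet_of_differentiableAt ℝ R).inter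
    ((ContinuousLinearMap.continuous_det.measurable.comp (measurable_fderiv ℝ R))
      (measurableSet_singleton 0).compl)

end Rademacher

section Taylor

variable {E : Type} [NormedAddCommGroup E] [NormedSpace ℝ E]

/-- The quadratic polynomial with prescribed value and derivatives at `p`. -/
noncomputable def taylorTwo (p : E) (a : ℝ) (L : E →L[ℝ] ℝ) (Q : E →L[ℝ] E →L[ℝ] ℝ) (w : E) : ℝ :=
  a + L (w - p) + 2⁻¹ * Q (w - p) (w - p)

variable (p : E) (a : ℝ) (L : E →L[ℝ] ℝ) (Q : E →L[ℝ] E →L[ℝ] ℝ)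

theorem taylorTwo_self : taylorTwo p a L Q p = a := by simp [taylorTwo]

theorem hasFDerivAt_taylorTwo (w : E) :
    HasFDerivAt (taylorTwo p a L Q) (L + (2⁻¹ : ℝ) • (Q + Q.flip) (w - p)) w := by
  have h1 : HasFDerivAt (fun w : E => w - p) (ContinuousLinearMap.id ℝ E) w :=
    (hasFDerivAt_id w).sub_const p
  have h2 := ((L.hasFDerivAt.comp w h1).const_add a).add
    (((Q.hasFDerivAt.comp w h1).clm_apply h1).const_mul (2⁻¹ : ℝ))
  refine h2.congr_fderiv ?_
  ext v
  simp

theorem fderiv_taylorTwo :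
    fderiv ℝ (taylorTwo p a L Q) = fun w => L + (2⁻¹ : ℝ) • (Q + Q.flip) (w - p) :=
  funext fun w => (hasFDerivAt_taylorTwo p a L Q w).fderiv

theorem fderiv_taylorTwo_self : fderiv ℝ (taylorTwo p a L Q) p = L := by
  simp [fderiv_taylorTwo]

theorem fderiv_fderiv_taylorTwo_self (h : E) :
    fderiv ℝ (fderiv ℝ (taylorTwo p a L Q)) p h h = Q h h := by
  have h1 : HasFDerivAt (fun w : E => w - p) (ContinuousLinearMap.id ℝ E) p :=
    (hasFDerivAt_id p).sub_const p
  have h2 := ((((Q + Q.flip).hasFDerivAt.comp p h1).const_smul (2⁻¹ : ℝ))).const_add L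
  have h3 : HasFDerivAt (fderiv ℝ (taylorTwo p a L Q))
      ((2⁻¹ : ℝ) • (Q + Q.flip).comp (ContinuousLinearMap.id ℝ E)) p := by
    rw [fderiv_taylorTwo]; exact h2
  rw [h3.fderiv]
  simp
  ring

variable {E : Type} [NormedAddCommGroup E] [InnerProductSpace ℝ E]

theorem isQuadraticPolynomial_taylorTwo (p : E) (a : ℝ) (L : E →L[ℝ] ℝ)
    (Q : E →L[ℝ] E →L[ℝ] ℝ) : IsQuadraticPolynomial (taylorTwo p a L Q) := by
  refine ⟨a - L p + 2⁻¹ * Q p p, L - (2⁻¹ : ℝ) • (Q + Q.flip) p, (2⁻¹ : ℝ) • Q, ?_⟩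
  ext w
  simp [taylorTwo]
  ring

theorem abs_sub_taylorTwo_le {R : E → E} {e : E → ℝ}
    (he : ∀ y, HasFDerivAt e (innerSL ℝ (R y)) y) {p : E} {A : E →L[ℝ] E} {ε δ : ℝ}
    (hA : ∀ w, ‖w - p‖ < δ → ‖R w - R p - A (w - p)‖ ≤ ε * ‖w - p‖) {w : E} (hw : ‖w - p‖ < δ)
    (hε : 0 ≤ ε) :
    |e w - taylorTwo p (e p) (innerSL ℝ (R p)) ((innerSL ℝ).comp A) w| ≤ ε * ‖w - p‖ ^ 2 := by
  set h := w - p with hh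
  let φ : ℝ → ℝ := fun t => e (p + t • h) - t * ⟪R p, h⟫ - t ^ 2 * (2⁻¹ * ⟪A h, h⟫)
  have hφ : ∀ t, HasDerivAt φ (⟪R (p + t • h) - R p - A (t • h), h⟫) t := by
    intro t
    have h1 : HasDerivAt (fun t : ℝ => p + t • h) h t := by
      simpa using ((hasDerivAt_id t).smul_const h).const_add p
    have h2 := (he (p + t • h)).comp_hasDerivAt t h1
    have h3 := (h2.sub ((hasDerivAt_id t).mul_const ⟪R p, h⟫)).sub
      (((hasDerivAt_id t).pow 2).mul_const (2⁻¹ * ⟪A h, h⟫))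
    refine h3.congr_deriv ?_
    simp [inner_sub_left, inner_smul_left]
    ring
  have key := norm_image_sub_le_of_norm_deriv_le_segment_01' (f := φ) (C := ε * ‖h‖ ^ 2)
    (fun t _ => (hφ t).hasDerivWithinAt) fun t ht => by
      refine (norm_inner_le_norm _ _).trans ?_
      have hn : ‖t • h‖ ≤ ‖h‖ := by
        rw [norm_smul, Real.norm_eq_abs, abs_of_nonneg ht.1]
        exact mul_le_of_le_one_left (norm_nonneg _) ht.2.le
      have h1 := hA (p + t • h) (by simpa using hn.trans_lt hw)
      rw [add_sub_cancel_left] at h1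
      calc _ ≤ (ε * ‖h‖) * ‖h‖ := by gcongr; exact h1.trans (by gcongr)
        _ = _ := by ring
  rw [Real.norm_eq_abs] at key
  convert key using 2
  simp [φ, taylorTwo, hh, inner_sub_left]
  ring

variable [FiniteDimensional ℝ E] [MeasurableSpace E] [BorelSpace E]

theorem exists_contDiff_two_of_uniform_fderiv {R : E → E} {e : E → ℝ}
    (he : ∀ y, HasFDerivAt e (innerSL ℝ (R y)) y) {P : Set E} (hP : IsClosed P) (hne : P.Nonempty)
    {A : E → E →L[ℝ] E} (hA : ∀ ε > 0, ∃ δ > 0, ∀ p ∈ P, ∀ w, ‖w - p‖ < δ →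
      ‖R w - R p - A p (w - p)‖ ≤ ε * ‖w - p‖) :
    ∃ f : E → ℝ, ContDiff ℝ 2 f ∧ ∀ p ∈ P, f p = e p ∧ fderiv ℝ f p = innerSL ℝ (R p) ∧
      ∀ h, fderiv ℝ (fderiv ℝ f) p h h = ⟪A p h, h⟫ := by
  obtain ⟨f, hf, H⟩ := exists_contDiff_two_eq_on hP hne (g := e)
    (T := fun p => taylorTwo p (e p) (innerSL ℝ (R p)) ((innerSL ℝ).comp (A p)))
    (continuous_iff_continuousAt.2 fun y => (he y).continuousAt)
    (fun p _ => isQuadraticPolynomial_taylorTwo _ _ _ _) fun ε hε => by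
      obtain ⟨δ, hδ, h⟩ := hA ε hε
      exact ⟨δ, hδ, fun p hp w hw => abs_sub_taylorTwo_le he (h p hp) hw hε.le⟩
  refine ⟨f, hf, fun p hp => ⟨?_, ?_, fun h => ?_⟩⟩
  · have := DFunLike.congr_fun (H p hp 0 (by norm_num)) 0
    simpa [taylorTwo_self] using this
  · ext v
    have := DFunLike.congr_fun (H p hp 1 (by norm_num)) fun _ => v
    simpa [fderiv_taylorTwo_self] using this
  · have := DFunLike.congr_fun (H p hp 2 le_rfl) fun _ => h
    simpa [iteratedFDeriv_two_apply, fderiv_fderiv_taylorTwo_self] using this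

end Taylor

section Legendre

variable {E : Type} [NormedAddCommGroup E] [InnerProductSpace ℝ E] [FiniteDimensional ℝ E]

theorem exists_contDiff_gradient {f : E → ℝ} (hf : ContDiff ℝ 2 f) :
    ∃ G : E → E, ContDiff ℝ 1 G ∧ (∀ x, fderiv ℝ f x = innerSL ℝ (G x)) ∧
      ∀ x h k, ⟪fderiv ℝ G x h, k⟫ = fderiv ℝ (fderiv ℝ f) x h k := by
  let b := stdOrthonormalBasis ℝ E
  have hd : ContDiff ℝ 1 (fderiv ℝ f) := hf.fderiv_right (by norm_num)
  let G : E → E := fun x => ∑ i, fderiv ℝ f x (b i) • b i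
  have hG : ContDiff ℝ 1 G := by
    refine ContDiff.sum fun i _ => ?_
    exact (hd.clm_apply contDiff_const).smul contDiff_const
  have hfG : ∀ x, fderiv ℝ f x = innerSL ℝ (G x) := by
    intro x
    ext v
    rw [innerSL_apply_apply]
    conv_lhs => rw [← b.sum_repr' v]
    simp only [G, map_sum, map_smul, sum_inner, inner_smul_left, smul_eq_mul]
    exact Finset.sum_congr rfl fun i _ => by simp [mul_comm]
  refine ⟨G, hG, hfG, fun x h k => ?_⟩
  have h1 := (hG.differentiable one_ne_zero x).hasFDerivAt
  have h2 : HasFDerivAt (fun y => fderiv ℝ f y k) ((innerSL ℝ k).comp (fderiv ℝ G x)) x := by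
    have : (fun y => fderiv ℝ f y k) = fun y => innerSL ℝ k (G y) := by
      ext y
      rw [hfG, innerSL_apply_apply, innerSL_apply_apply, real_inner_comm]
    rw [this]
    exact (innerSL ℝ k).hasFDerivAt.comp x h1
  have h3 := (hd.differentiable one_ne_zero x).hasFDerivAt.clm_apply (hasFDerivAt_const k x)
  have h4 := DFunLike.congr_fun (h2.unique h3) h
  simpa [real_inner_comm] using h4

omit [FiniteDimensional ℝ E] in
theorem contDiffOn_legendre {f : E → ℝ} {G Y : E → E} (hf : Differentiable ℝ f)
    (hG : ∀ x, fderiv ℝ f x = innerSL ℝ (G x)) {W : Set E} (hW : IsOpen W)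
    (hY : ContDiffOn ℝ 1 Y W) (hGY : ∀ z ∈ W, G (Y z) = z) :
    ContDiffOn ℝ 2 (fun z => ⟪z, Y z⟫ - f (Y z)) W := by
  have hd : ∀ z ∈ W, HasFDerivAt (fun z => ⟪z, Y z⟫ - f (Y z)) (innerSL ℝ (Y z)) z := by
    intro z hz
    have h1 := ((hY.differentiableOn one_ne_zero).differentiableAt (hW.mem_nhds hz)).hasFDerivAt
    have h2 := (hf (Y z)).hasFDerivAt.comp z h1
    have h3 := ((hasFDerivAt_id z).inner ℝ h1).sub h2
    refine h3.congr_fderiv ?_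
    ext v
    simp [hG, hGY z hz, real_inner_comm]
  rw [show (2 : ℕ∞ω) = 1 + 1 by norm_num, contDiffOn_succ_iff_fderiv_of_isOpen hW]
  refine ⟨fun z hz => (hd z hz).differentiableAt.differentiableWithinAt, fun h => by simp at h, ?_⟩
  refine ((innerSL ℝ : E →L[ℝ] E →L[ℝ] ℝ).contDiff.comp_contDiffOn hY).congr fun z hz => ?_
  exact (hd z hz).fderiv

theorem ContDiff.exists_open_local_inverse {G : E → E} (hG : ContDiff ℝ 1 G) {p : E}
    (hinj : Function.Injective (fderiv ℝ G p)) :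
    ∃ (U W : Set E) (Y : E → E), IsOpen U ∧ p ∈ U ∧ IsOpen W ∧ ContDiffOn ℝ 1 Y W ∧
      (∀ x ∈ U, G x ∈ W ∧ Y (G x) = x) ∧ ∀ z ∈ W, G (Y z) = z := by
  let L : E ≃L[ℝ] E :=
    (LinearEquiv.ofInjectiveEndo (fderiv ℝ G p : E →ₗ[ℝ] E) hinj).toContinuousLinearEquiv
  have hL : HasFDerivAt G (L : E →L[ℝ] E) p := by
    refine (hG.differentiable one_ne_zero p).hasFDerivAt.congr_fderiv ?_
    ext v
    rfl
  have hp := hG.contDiffAt (x := p)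
  let Φ := hp.toOpenPartialHomeomorph G hL one_ne_zero
  have hp1 : p ∈ Φ.source := hp.mem_toOpenPartialHomeomorph_source hL one_ne_zero
  have hsymm : ContDiffAt ℝ 1 Φ.symm (G p) := hp.to_localInverse hL one_ne_zero
  obtain ⟨V, hV, hVd⟩ := hsymm.contDiffOn le_rfl (by simp)
  obtain ⟨V', hV'V, hV'o, hpV'⟩ := _root_.mem_nhds_iff.1 hV
  refine ⟨Φ.source ∩ G ⁻¹' V', Φ.target ∩ V', Φ.symm, Φ.open_source.inter (hV'o.preimage hG.continuous),
    ⟨hp1, hpV'⟩, Φ.open_target.inter hV'o, hVd.mono fun z hz => hV'V hz.2,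
    fun x hx => ⟨⟨Φ.map_source hx.1, hx.2⟩, Φ.left_inv hx.1⟩, fun z hz => Φ.right_inv hz.1⟩

variable [MeasurableSpace E] [BorelSpace E]

theorem exists_contDiffOn_legendre {μ : Measure E} [μ.IsAddHaarMeasure]
    (hμ : μ = μH[Module.finrank ℝ E]) {R : E → E} {e : E → ℝ} {C : ℝ≥0} (hR : LipschitzWith C R)
    (he : ∀ y, HasFDerivAt e (innerSL ℝ (R y)) y)
    (hmono : ∀ y y', ‖R y - R y'‖ ^ 2 ≤ ⟪R y - R y', y - y'⟫) {O S : Set E} (hO : MeasurableSet O)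
    (hS : MeasurableSet S) (hSO : S ⊆ R '' O) (hS0 : μ S ≠ 0) :
    ∃ (W : Set E) (h : E → ℝ), IsOpen W ∧ ContDiffOn ℝ 2 h W ∧
      μ {z ∈ W ∩ S | ∃ y ∈ O, R y = z ∧ h z = ⟪z, y⟫ - e y} ≠ 0 := by
  have hRm : Measurable R := hR.continuous.measurable
  obtain ⟨P, hPsub, hP, hP0, hPu⟩ := exists_isCompact_uniform_fderiv hR.continuous
    ((hO.inter (hRm hS)).inter (measurableSet_differentiableAt_and_det_ne_zero R))
    (measure_inter_preimage_ne_zero_of_subset_image hμ hR hSO hS0) fun x hx => hx.2.1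
  obtain ⟨p, hpP, hpd⟩ := exists_mem_forall_mem_nhdsWithin_pos_measure hP0
  obtain ⟨f, hf, hfP⟩ := exists_contDiff_two_of_uniform_fderiv he hP.isClosed ⟨p, hpP⟩ hPu
  obtain ⟨G, hG, hfG, hGf⟩ := exists_contDiff_gradient hf
  have hGR : ∀ x ∈ P, G x = R x := by
    intro x hx
    refine ext_inner_right ℝ fun v => ?_
    have := DFunLike.congr_fun ((hfG x).symm.trans (hfP x hx).2.1) v
    simpa using this
  have hinj : Function.Injective (fderiv ℝ G p) := by
    rw [injective_iff_map_eq_zero]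
    intro h hh
    have h1 := hGf p h h
    rw [hh, inner_zero_left, (hfP p hpP).2.2 h] at h1
    have hRd := (hPsub hpP).2.1.hasFDerivAt
    have h2 : ‖fderiv ℝ R p h‖ ^ 2 ≤ ⟪fderiv ℝ R p h, h⟫ := by
      have hl : Tendsto (fun n : ℕ => ((n : ℝ)) • (R (p + ((n : ℝ))⁻¹ • h) - R p)) atTop
          (𝓝 (fderiv ℝ R p h)) := by
        have := hRd.lim_real h
        exact (this.comp tendsto_natCast_atTop_atTop)
      refine le_of_tendsto_of_tendsto (hl.norm.pow 2) (hl.inner tendsto_const_nhds) ?_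
      filter_upwards [eventually_gt_atTop 0] with n hn
      have h3 := hmono (p + ((n : ℝ))⁻¹ • h) p
      have hn' : (0 : ℝ) < n := by exact_mod_cast hn
      rw [add_sub_cancel_left, inner_smul_right] at h3
      rw [norm_smul, inner_smul_left, mul_pow, Real.norm_eq_abs, sq_abs]
      have h4 := mul_le_mul_of_nonneg_left h3 (sq_nonneg (n : ℝ))
      refine h4.trans (le_of_eq ?_)
      simp
      field_simp
    have h3 : fderiv ℝ R p h = 0 := by
      rw [← norm_eq_zero, ← sq_eq_zero_iff]
      exact le_antisymm (h2.trans h1.symm.le) (sq_nonneg _)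
    have h4 : Function.Injective (fderiv ℝ R p) := by
      exact ((fderiv ℝ R p : E →ₗ[ℝ] E).equivOfDetNeZero (hPsub hpP).2.2).injective
    exact h4 (by rw [h3, map_zero])
  obtain ⟨U, W, Y, hU, hpU, hW, hY, hYG, hGY⟩ := hG.exists_open_local_inverse hinj
  refine ⟨W, fun z => ⟪z, Y z⟫ - f (Y z), hW,
    contDiffOn_legendre (hf.differentiable two_ne_zero) hfG hW hY hGY, fun h0 => ?_⟩
  have h1 : μ (U ∩ P) = 0 := by
    have h2 := addHaar_image_eq_zero_of_differentiableOn_of_addHaar_eq_zero μ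
      ((hY.differentiableOn one_ne_zero).mono fun z hz => hz.1.1) h0
    refine measure_mono_null (fun x hx => ?_) h2
    refine ⟨G x, ⟨⟨(hYG x hx.1).1, ?_⟩, x, (hPsub hx.2).1.1, (hGR x hx.2).symm, ?_⟩, (hYG x hx.1).2⟩
    · rw [hGR x hx.2]
      exact (hPsub hx.2).1.2
    · dsimp only
      rw [(hYG x hx.1).2, (hfP x hx.2).1]
  exact (hpd _ (inter_mem (mem_nhdsWithin_of_mem_nhds (hU.mem_nhds hpU)) self_mem_nhdsWithin)).ne' h1

end Legendre

section Subgradient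

variable {E : Type} [NormedAddCommGroup E] [InnerProductSpace ℝ E]

theorem IsSubgradient.eq_of_differentiableAt {g : E → ℝ} {η z z' : E} (h : IsSubgradient g η z)
    (h' : IsSubgradient g η z') (hd : DifferentiableAt ℝ g η) : z = z' := by
  have key : ∀ {w : E}, IsSubgradient g η w → fderiv ℝ g η = innerSL ℝ w := by
    intro w hw
    have h1 : IsLocalMin (g - ⇑(innerSL ℝ w)) η := Eventually.of_forall fun η' => by
      have := hw η'
      simp only [Pi.sub_apply, innerSL_apply_apply]
      rw [inner_sub_right] at this
      linarith
    have h2 := h1.hasFDerivAt_eq_zero (hd.hasFDerivAt.sub (innerSL ℝ w).hasFDerivAt)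
    exact sub_eq_zero.1 h2
  refine ext_inner_right ℝ fun v => ?_
  simpa using DFunLike.congr_fun ((key h).symm.trans (key h')) v

theorem convexOn_of_forall_exists_isSubgradient {g : E → ℝ} (h : ∀ η, ∃ z, IsSubgradient g η z) :
    ConvexOn ℝ univ g := by
  refine ⟨convex_univ, fun x _ y _ a b ha hb hab => ?_⟩
  obtain ⟨z, hz⟩ := h (a • x + b • y)
  have h1 := mul_le_mul_of_nonneg_left (hz x) ha
  have h2 := mul_le_mul_of_nonneg_left (hz y) hb
  have h3 : a * ⟪z, x - (a • x + b • y)⟫ + b * ⟪z, y - (a • x + b • y)⟫ = 0 := by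
    rw [← real_inner_smul_right, ← real_inner_smul_right, ← inner_add_right]
    have : a • (x - (a • x + b • y)) + b • (y - (a • x + b • y)) =
        (1 - (a + b)) • (a • x + b • y) := by module
    rw [this, hab]
    simp
  simp only [smul_eq_mul]
  have h4 : g (a • x + b • y) = a * g (a • x + b • y) + b * g (a • x + b • y) := by
    rw [← add_mul, hab, one_mul]
  linarith

theorem exists_isSubgradient_of_lt_on_sphere [FiniteDimensional ℝ E] {g : E → ℝ}
    (hg : ConvexOn ℝ univ g) (hc : Continuous g) {r : ℝ} (hr : 0 < r)
    (h : ∀ η, ‖η‖ = r → g 0 < g η) :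
    ∃ s > 0, ∀ z, ‖z‖ < s → ∃ η, ‖η‖ < r ∧ IsSubgradient g η z := by
  have hm : ∃ m, g 0 < m ∧ ∀ η, ‖η‖ = r → m ≤ g η := by
    rcases (sphere (0 : E) r).eq_empty_or_nonempty with h0 | h0
    · refine ⟨g 0 + 1, by linarith, fun η hη => ?_⟩
      exact absurd (mem_sphere_zero_iff_norm.2 hη) (by simp [h0])
    · obtain ⟨η, hη, hmin⟩ := (isCompact_sphere (0 : E) r).exists_isMinOn h0 hc.continuousOn
      exact ⟨g η, h η (mem_sphere_zero_iff_norm.1 hη), fun η' h' =>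
        hmin (mem_sphere_zero_iff_norm.2 h')⟩
  obtain ⟨m, hm0, hm⟩ := hm
  refine ⟨(m - g 0) / r, div_pos (by linarith) hr, fun z hz => ?_⟩
  rw [lt_div_iff₀ hr] at hz
  have hc' : Continuous fun η => g η - ⟪z, η⟫ := by fun_prop
  obtain ⟨η, hη, hmin⟩ := (isCompact_closedBall (0 : E) r).exists_isMinOn
    ⟨0, mem_closedBall_self hr.le⟩ hc'.continuousOn
  have hηr : ‖η‖ < r := by
    refine lt_of_le_of_ne (mem_closedBall_zero_iff.1 hη) fun he => ?_
    have h1 : g η - ⟪z, η⟫ ≤ g 0 - ⟪z, 0⟫ := hmin (mem_closedBall_self hr.le)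
    have h2 := (le_abs_self _).trans (abs_real_inner_le_norm z η)
    rw [inner_zero_right, sub_zero] at h1
    rw [he] at h2
    linarith [hm η he]
  refine ⟨η, hηr, fun η' => ?_⟩
  have hloc : IsLocalMin (fun η => g η - ⟪z, η⟫) η :=
    hmin.isLocalMin (closedBall_mem_nhds_of_mem (by simpa using hηr))
  have hconv : ConvexOn ℝ univ fun η => g η - ⟪z, η⟫ :=
    hg.sub ((innerSL ℝ z : E →L[ℝ] ℝ).toLinearMap.concaveOn convex_univ)
  have h3 := IsMinOn.of_isLocalMin_of_convex_univ hloc hconv η'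
  rw [inner_sub_right]
  linarith

variable [FiniteDimensional ℝ E] [MeasurableSpace E] [BorelSpace E]

/-- The convex conjugate `z ↦ ⟪z, η⟫ - g η` of a convex function coincides on a set of positive
measure with a function of class `C^2`. -/
theorem exists_contDiffOn_conjugate {g : E → ℝ} (hg : ConvexOn ℝ univ g) (hc : Continuous g)
    {O S : Set E} (hO : IsOpen O) (hS : MeasurableSet S)
    (hSO : ∀ z ∈ S, ∃ η ∈ O, IsSubgradient g η z)
    (hS0 : (μH[Module.finrank ℝ E] : Measure E) S ≠ 0) :
    ∃ (W : Set E) (h : E → ℝ), IsOpen W ∧ ContDiffOn ℝ 2 h W ∧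
      (μH[Module.finrank ℝ E] : Measure E)
        {z ∈ W ∩ S | ∃ η ∈ O, IsSubgradient g η z ∧ h z = ⟪z, η⟫ - g η} ≠ 0 := by
  obtain ⟨z₀, hz₀⟩ := nonempty_of_measure_ne_zero hS0
  obtain ⟨η₀, -, h₀⟩ := hSO z₀ hz₀
  obtain ⟨R, e, hsub, hRl, he, hmono, heq, hR⟩ := exists_moreau_envelope hg hc h₀
  have hO' : IsOpen {y | y - R y ∈ O} := hO.preimage (continuous_id.sub hRl.continuous)
  obtain ⟨W, h, hW, hh, hpos⟩ := exists_contDiffOn_legendre (μ := μH[Module.finrank ℝ E]) rfl hRl he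
    hmono hO'.measurableSet hS (fun z hz => by
      obtain ⟨η, hη, h⟩ := hSO z hz
      refine ⟨η + z, ?_, hR η z h⟩
      simpa [hR η z h] using hη) hS0
  refine ⟨W, fun z => h z - ‖z‖ ^ 2 / 2, hW,
    hh.sub ((contDiff_norm_sq ℝ).div_const 2).contDiffOn, fun h0 => hpos (measure_mono_null ?_ h0)⟩
  rintro z ⟨hzW, y, hy, rfl, hz⟩
  refine ⟨hzW, y - R y, hy, hsub y, ?_⟩
  dsimp only
  rw [hz, heq y, inner_sub_right, real_inner_self_eq_norm_sq]
  ring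

end Subgradient

section Distance

variable {E V : Type} [NormedAddCommGroup E] [InnerProductSpace ℝ E] [NormedAddCommGroup V]
  [InnerProductSpace ℝ V]

/-- Half the difference of the squared norm and the squared distance from `K`, on the affine
subspace through `x` parametrized by the linear isometry `ι`. -/
noncomputable def distPotential (K : Set V) (x : V) (ι : E →ₗᵢ[ℝ] V) (η : E) : ℝ :=
  ‖η‖ ^ 2 / 2 - infDist (x + ι η) K ^ 2 / 2

variable {K : Set V} {x : V} {ι : E →ₗᵢ[ℝ] V}

theorem continuous_distPotential : Continuous (distPotential K x ι) := by
  have h1 : Continuous fun η => infDist (x + ι η) K :=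
    (continuous_infDist_pt K).comp (continuous_const.add ι.continuous)
  unfold distPotential
  fun_prop

theorem DifferentiableAt.distPotential {η : E}
    (h : DifferentiableAt ℝ (fun y => infDist y K) (x + ι η)) :
    DifferentiableAt ℝ (distPotential K x ι) η := by
  have h1 : DifferentiableAt ℝ (fun η => infDist (x + ι η) K) η :=
    DifferentiableAt.comp (g := fun y => infDist y K) η h
      (ι.toContinuousLinearMap.differentiableAt.const_add x)
  have h2 : DifferentiableAt ℝ (fun η : E => ‖η‖ ^ 2) η :=
    ((contDiff_norm_sq ℝ (n := 1)).differentiable one_ne_zero) η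
  unfold _root_.distPotential
  fun_prop

theorem distPotential_eq {η : E} {a : V} (h : infDist (x + ι η) K = dist (x + ι η) a) :
    distPotential K x ι η = ⟪a - x, ι η⟫ - ‖a - x‖ ^ 2 / 2 := by
  rw [distPotential, h, dist_eq_norm, show x + ι η - a = ι η - (a - x) by abel,
    norm_sub_sq_real, ι.norm_map, real_inner_comm]
  ring

theorem le_distPotential (η : E) {a : V} (ha : a ∈ K) :
    ⟪a - x, ι η⟫ - ‖a - x‖ ^ 2 / 2 ≤ distPotential K x ι η := by
  have h1 : infDist (x + ι η) K ^ 2 ≤ dist (x + ι η) a ^ 2 :=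
    pow_le_pow_left₀ infDist_nonneg (infDist_le_dist_of_mem ha) 2
  rw [dist_eq_norm, show x + ι η - a = ι η - (a - x) by abel,
    norm_sub_sq_real, ι.norm_map, real_inner_comm] at h1
  rw [distPotential]
  linarith

theorem isSubgradient_distPotential {η z : E} {a : V} (ha : a ∈ K)
    (h : infDist (x + ι η) K = dist (x + ι η) a) (hz : ∀ w, ⟪z, w⟫ = ⟪a - x, ι w⟫) :
    IsSubgradient (distPotential K x ι) η z := by
  intro η'
  have := le_distPotential (x := x) (ι := ι) η' ha
  rw [distPotential_eq h, hz, map_sub, inner_sub_right]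
  linarith

theorem nearest_unique_of_differentiableAt {a b : V} (ha : a ∈ K) (hb : b ∈ K)
    (hxa : infDist x K = dist x a) (hxb : infDist x K = dist x b)
    (hd : DifferentiableAt ℝ (fun y => infDist y K) x) : a = b := by
  have h1 : ∀ {c}, c ∈ K → infDist x K = dist x c →
      IsSubgradient (distPotential K x (LinearIsometry.id (R := ℝ) (E := V))) 0 (c - x) :=
    fun hc h => isSubgradient_distPotential hc (by simpa using h) fun w => by simp
  exact sub_left_injective ((h1 ha hxa).eq_of_differentiableAt (h1 hb hxb)
    (DifferentiableAt.distPotential (by simpa using hd)))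

end Distance

section Hypersurface

variable {n : ℕ} {K : Set (EuclideanSpace ℝ (Fin n))}

theorem IsC1Hypersurface.exists_tangent (hK : IsC1Hypersurface K) {a : EuclideanSpace ℝ (Fin n)}
    (ha : a ∈ K) : ∃ T : Submodule ℝ (EuclideanSpace ℝ (Fin n)), Module.finrank ℝ T = n - 1 ∧
      ∀ x, infDist x K = dist x a → x - a ∈ Tᗮ := by
  obtain ⟨U, hU, haU, Z, hZ, σ, τ, ⟨hσU, hσ, hτ, hτσ, hστ⟩, him⟩ := hK a ha
  have hσa : σ a ∈ σ '' U := mem_image_of_mem σ haU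
  have hσaZ : σ a ∈ (Z : Set _) := (him.subset ⟨a, ⟨haU, ha⟩, rfl⟩).1
  have hdσ := ((hσ.differentiableOn one_ne_zero).differentiableAt (hU.mem_nhds haU)).hasFDerivAt
  have hdτ := ((hτ.differentiableOn one_ne_zero).differentiableAt (hσU.mem_nhds hσa)).hasFDerivAt
  set D := fderiv ℝ τ (σ a)
  have hinj : Function.Injective D := by
    have h1 : HasFDerivAt (σ ∘ τ) ((fderiv ℝ σ a).comp D) (σ a) := by
      refine HasFDerivAt.comp (σ a) ?_ hdτ
      rwa [hτσ a haU]
    have h2 : HasFDerivAt (σ ∘ τ) (ContinuousLinearMap.id ℝ _) (σ a) :=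
      (hasFDerivAt_id _).congr_of_eventuallyEq
        (Filter.mem_of_superset (hσU.mem_nhds hσa) fun y hy => hστ y hy)
    intro u v huv
    have h3 := h1.unique h2
    have h4 : ∀ w, fderiv ℝ σ a (D w) = w := fun w => DFunLike.congr_fun h3 w
    rw [← h4 u, ← h4 v, huv]
  refine ⟨Z.map (D : EuclideanSpace ℝ (Fin n) →ₗ[ℝ] EuclideanSpace ℝ (Fin n)), ?_, fun x hx => ?_⟩
  · rw [← hZ]
    exact ((Z.equivMapOfInjective (D : EuclideanSpace ℝ (Fin n) →ₗ[ℝ] EuclideanSpace ℝ (Fin n)) hinj).finrank_eq).symm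
  · rw [Submodule.mem_orthogonal]
    rintro _ ⟨z, hz, rfl⟩
    let c : ℝ → EuclideanSpace ℝ (Fin n) := fun t => τ (σ a + t • z)
    have hline : HasDerivAt (fun t : ℝ => σ a + t • z) z 0 := by
      simpa using ((hasDerivAt_id (0 : ℝ)).smul_const z).const_add (σ a)
    have hc0 : c 0 = a := by simp [c, hτσ a haU]
    have hc : HasDerivAt c (D z) 0 := by
      refine HasFDerivAt.comp_hasDerivAt (0 : ℝ) (l := τ) (f := fun t : ℝ => σ a + t • z) ?_ hline
      simpa using hdτ
    have hcK : ∀ᶠ t in 𝓝 0, c t ∈ K := by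
      have h1 : ∀ᶠ t : ℝ in 𝓝 0, σ a + t • z ∈ σ '' U :=
        hline.continuousAt.eventually_mem (hσU.mem_nhds (by simpa using hσa))
      filter_upwards [h1] with t ht
      obtain ⟨b, ⟨hbU, hbK⟩, hb⟩ := him.superset ⟨Z.add_mem hσaZ (Z.smul_mem t hz), ht⟩
      simp only [c, ← hb, hτσ b hbU, hbK]
    have hmin : IsLocalMin (fun t => ‖x - c t‖ ^ 2) 0 := by
      filter_upwards [hcK] with t ht
      have h1 := infDist_le_dist_of_mem (x := x) ht
      rw [hx, dist_eq_norm, dist_eq_norm] at h1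
      rw [hc0]
      exact pow_le_pow_left₀ (norm_nonneg _) h1 2
    have h2 := hmin.hasDerivAt_eq_zero (hc.const_sub x).norm_sq
    rw [hc0, inner_neg_right] at h2
    rw [real_inner_comm]
    simpa using h2

theorem IsC1Hypersurface.interior_eq_empty (hn : n ≠ 0) (hK : IsC1Hypersurface K) :
    interior K = ∅ := by
  refine eq_empty_of_forall_notMem fun a ha => ?_
  obtain ⟨U, hU, haU, Z, hZ, σ, τ, ⟨hσU, hσ, hτ, hτσ, hστ⟩, him⟩ := hK a (interior_subset ha)
  have hO : IsOpen (σ '' U ∩ τ ⁻¹' (U ∩ interior K)) :=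
    hτ.continuousOn.isOpen_inter_preimage hσU (hU.inter isOpen_interior)
  have hsub : σ '' U ∩ τ ⁻¹' (U ∩ interior K) ⊆ Z := by
    rintro y ⟨hy, h1, h2⟩
    exact (him.subset ⟨τ y, ⟨h1, interior_subset h2⟩, hστ y hy⟩).1
  have htop : Z = ⊤ := Submodule.eq_top_of_nonempty_interior' Z
    ⟨σ a, mem_interior.2 ⟨_, hsub, hO, mem_image_of_mem σ haU, by
      simpa [hτσ a haU] using ⟨haU, ha⟩⟩⟩
  rw [htop, finrank_top, finrank_euclideanSpace_fin] at hZ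
  omega

theorem isC2Hypersurface_graph (x₀ : EuclideanSpace ℝ (Fin n))
    (H : Submodule ℝ (EuclideanSpace ℝ (Fin n))) (hH : Module.finrank ℝ H = n - 1)
    {u : EuclideanSpace ℝ (Fin n)} (hu : u ∈ Hᗮ) {W : Set H} (hW : IsOpen W) {s : H → ℝ}
    (hs : ContDiffOn ℝ 2 s W) :
    IsC2Hypersurface ((fun z : H => x₀ + (z : EuclideanSpace ℝ (Fin n)) + s z • u) '' W) := by
  let π := H.orthogonalProjectionOnto
  have hπH : ∀ z : H, π (z : EuclideanSpace ℝ (Fin n)) = z := fun z =>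
    Submodule.orthogonalProjectionOnto_mem_subspace_eq_self z
  have hπu : π u = 0 := Submodule.orthogonalProjectionOnto_apply_of_mem_orthogonal hu
  let σ : EuclideanSpace ℝ (Fin n) → EuclideanSpace ℝ (Fin n) :=
    fun x => x - x₀ - s (π (x - x₀)) • u
  let τ : EuclideanSpace ℝ (Fin n) → EuclideanSpace ℝ (Fin n) := fun y => x₀ + y + s (π y) • u
  let U : Set (EuclideanSpace ℝ (Fin n)) := {x | π (x - x₀) ∈ W}
  have hτσ : ∀ x, τ (σ x) = x := fun x => by
    simp only [τ, σ, map_sub, map_smul, hπu, smul_zero, sub_zero]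
    abel
  have hστ : ∀ y, σ (τ y) = y := fun y => by
    have h1 : τ y - x₀ = y + s (π y) • u := by simp only [τ]; abel
    have h2 : π (τ y - x₀) = π y := by simp [h1, hπu]
    simp only [σ]
    rw [h2, h1]
    abel
  have hπτ : ∀ y, π (τ y - x₀) = π y := fun y => by
    have h1 : τ y - x₀ = y + s (π y) • u := by simp only [τ]; abel
    simp [h1, hπu]
  have hσU : σ '' U = {y | π y ∈ W} := by
    ext y
    constructor
    · rintro ⟨x, hx, rfl⟩
      have : π (σ x) = π (x - x₀) := by rw [← hπτ, hτσ]
      rw [mem_ofPred_eq, this]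
      exact hx
    · intro hy
      exact ⟨τ y, by rwa [mem_ofPred_eq, ← hπτ] at hy, hστ y⟩
  have hUo : IsOpen U := hW.preimage (π.continuous.comp (continuous_id.sub continuous_const))
  rintro _ ⟨z, hz, rfl⟩
  refine ⟨U, hUo, ?_, H, hH, σ, τ, ⟨?_, ?_, ?_, fun x _ => hτσ x, fun y _ => hστ y⟩, ?_⟩
  · have : π (τ z - x₀) ∈ W := by rwa [hπτ, hπH]
    simp only [τ, hπH] at this
    exact this
  · rw [hσU]
    exact hW.preimage π.continuous
  · have h1 : ContDiff ℝ 2 fun x : EuclideanSpace ℝ (Fin n) => π (x - x₀) :=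
      π.contDiff.comp (contDiff_id.sub contDiff_const)
    have h2 : ContDiffOn ℝ 2 (fun x => s (π (x - x₀))) U := hs.comp h1.contDiffOn fun x hx => hx
    exact ((contDiff_id.sub contDiff_const).contDiffOn).sub (h2.smul contDiffOn_const)
  · rw [hσU]
    have h2 : ContDiffOn ℝ 2 (fun y => s (π y)) {y | π y ∈ W} :=
      hs.comp π.contDiff.contDiffOn fun x hx => hx
    exact ((contDiff_const.add contDiff_id).contDiffOn).add (h2.smul contDiffOn_const)
  · rw [hσU]
    ext y
    constructor
    · rintro ⟨_, ⟨-, z', hz', rfl⟩, rfl⟩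
      have : σ (x₀ + z' + s z' • u) = z' := by
        have := hστ z'
        simpa only [τ, hπH] using this
      rw [this]
      exact ⟨z'.2, by simpa [hπH] using hz'⟩
    · rintro ⟨hyH, hyW⟩
      have h1 := hπH ⟨y, hyH⟩
      dsimp only at h1
      refine ⟨τ y, ⟨by rw [mem_ofPred_eq, ← hπτ] at hyW; exact hyW, ⟨y, hyH⟩, ?_, ?_⟩, hστ y⟩
      · rw [← h1]; exact hyW
      · simp only [τ, h1]

theorem isC2Hypersurface_univ_of_eq_zero (hn : n = 0) :
    IsC2Hypersurface (univ : Set (EuclideanSpace ℝ (Fin n))) := by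
  intro a _
  refine ⟨univ, isOpen_univ, mem_univ _, ⊤, ?_, id, id, ⟨?_, contDiffOn_id, contDiffOn_id,
    fun _ _ => rfl, fun _ _ => rfl⟩, ?_⟩
  · rw [finrank_top, finrank_euclideanSpace_fin]; omega
  · simp
  · simp

end Hypersurface

section Density

variable {n : ℕ} {K : Set (EuclideanSpace ℝ (Fin n))}

theorem inner_orthogonalProjectionOnto_apply {V : Type} [NormedAddCommGroup V]
    [InnerProductSpace ℝ V] [FiniteDimensional ℝ V] (H : Submodule ℝ V) (x : V) (w : H) :
    ⟪H.orthogonalProjectionOnto x, w⟫ = ⟪x, H.subtypeₗᵢ w⟫ :=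
  Submodule.inner_orthogonalProjectionOnto_eq_of_mem_right w x

/-- At the foot point `a₀` of `x₀`, the potential restricted to the hyperplane through `x₀`
parallel to the tangent space has a strict minimum at the origin. -/
theorem distPotential_zero_lt (hn : n ≠ 0) (hK : IsClosed K) (hsurf : IsC1Hypersurface K)
    {x₀ a₀ : EuclideanSpace ℝ (Fin n)} (ha₀ : a₀ ∈ K) (hx₀ : infDist x₀ K = dist x₀ a₀)
    (hne : x₀ ≠ a₀) (hd₀ : DifferentiableAt ℝ (fun y => infDist y K) x₀)
    {H : Submodule ℝ (EuclideanSpace ℝ (Fin n))} (hH : x₀ - a₀ ∈ Hᗮ) {η : H} (hη : η ≠ 0)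
    (hd : DifferentiableAt ℝ (fun y => infDist y K) (x₀ + H.subtypeₗᵢ η)) :
    distPotential K x₀ H.subtypeₗᵢ 0 < distPotential K x₀ H.subtypeₗᵢ η := by
  have h0 : IsSubgradient (distPotential K x₀ H.subtypeₗᵢ) 0 0 := by
    refine isSubgradient_distPotential ha₀ (by simpa using hx₀) fun w => ?_
    rw [inner_zero_left, ← neg_sub, inner_neg_left, real_inner_comm]
    simpa using (Submodule.mem_orthogonal _ _).1 hH w w.2
  have hle : ∀ η', distPotential K x₀ H.subtypeₗᵢ 0 ≤ distPotential K x₀ H.subtypeₗᵢ η' :=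
    fun η' => by simpa using h0 η'
  refine lt_of_le_of_ne (hle η) fun heq => hη ?_
  obtain ⟨a, ha, hxa⟩ := hK.exists_infDist_eq_dist ⟨a₀, ha₀⟩ (x₀ + H.subtypeₗᵢ η)
  have h1 : IsSubgradient (distPotential K x₀ H.subtypeₗᵢ) η 0 := fun η' => by
    rw [← heq]; simpa using hle η'
  have h2 := isSubgradient_distPotential ha hxa (inner_orthogonalProjectionOnto_apply H (a - x₀))
  have h3 := h1.eq_of_differentiableAt h2 (DifferentiableAt.distPotential hd)
  have h4 := distPotential_eq (ι := H.subtypeₗᵢ) hxa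
  rw [← inner_orthogonalProjectionOnto_apply, ← h3, inner_zero_left, ← heq,
    distPotential_eq (by simpa using hx₀)] at h4
  simp only [map_zero, inner_zero_right, zero_sub, neg_inj] at h4
  have h5 : infDist x₀ K = dist x₀ a := by
    rw [hx₀, dist_comm, dist_comm x₀, dist_eq_norm, dist_eq_norm,
      ← sq_eq_sq₀ (norm_nonneg _) (norm_nonneg _)]
    linarith
  obtain rfl := nearest_unique_of_differentiableAt ha₀ ha hx₀ h5 hd₀
  obtain ⟨T, hT, hperp⟩ := hsurf.exists_tangent ha₀
  have hT1 : Module.finrank ℝ Tᗮ = 1 := by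
    have := T.finrank_add_finrank_orthogonal
    rw [finrank_euclideanSpace_fin, hT] at this
    omega
  obtain ⟨c, hc⟩ := (finrank_eq_one_iff_of_nonzero' (⟨x₀ - a₀, hperp _ hx₀⟩ : Tᗮ)
    (fun h => hne (sub_eq_zero.1 (congrArg Subtype.val h)))).1 hT1
    ⟨x₀ + H.subtypeₗᵢ η - a₀, hperp _ hxa⟩
  have h6 : (η : EuclideanSpace ℝ (Fin n)) = (c - 1) • (x₀ - a₀) := by
    have := congrArg Subtype.val hc
    simp only [Submodule.coe_smul, Submodule.coe_subtypeₗᵢ, Submodule.subtype_apply] at this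
    rw [sub_smul, this, one_smul]
    simp
  have h7 : (η : EuclideanSpace ℝ (Fin n)) ∈ Hᗮ := h6 ▸ Hᗮ.smul_mem _ hH
  have h8 := (Submodule.mem_orthogonal _ _).1 h7 η η.2
  exact Subtype.ext (inner_self_eq_zero.1 h8)

theorem eq_orthogonalProjectionOnto_add_inner_smul {V : Type} [NormedAddCommGroup V] [InnerProductSpace ℝ V]
    [FiniteDimensional ℝ V] {u : V} (hu : ‖u‖ = 1) (v : V) :
    v = (((ℝ ∙ u)ᗮ.orthogonalProjectionOnto v : (ℝ ∙ u)ᗮ) : V) + ⟪u, v⟫ • u := by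
  have h := (ℝ ∙ u).starProjection_add_starProjection_orthogonal v
  rw [Submodule.starProjection_unit_singleton ℝ hu, add_comm] at h
  exact h.symm

end Density

section Main

variable {n : ℕ} {K : Set (EuclideanSpace ℝ (Fin n))}

theorem hausdorffMeasure_graph_projection_eq_zero
    (hunrect : ∀ M : Set (EuclideanSpace ℝ (Fin n)), IsC2Hypersurface M →
      μH[(n : ℝ) - 1] (K ∩ M) = 0)
    (hn : n ≠ 0) (x₀ : EuclideanSpace ℝ (Fin n)) {H : Submodule ℝ (EuclideanSpace ℝ (Fin n))}
    (hH : Module.finrank ℝ H = n - 1) {u : EuclideanSpace ℝ (Fin n)} (hu : u ∈ Hᗮ) {W : Set H}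
    (hW : IsOpen W) {s : H → ℝ} (hs : ContDiffOn ℝ 2 s W) :
    (μH[Module.finrank ℝ H] : Measure H)
      {z ∈ W | x₀ + (z : EuclideanSpace ℝ (Fin n)) + s z • u ∈ K} = 0 := by
  have hd : ((Module.finrank ℝ H : ℕ) : ℝ) = (n : ℝ) - 1 := by
    rw [hH, Nat.cast_sub (Nat.one_le_iff_ne_zero.2 hn), Nat.cast_one]
  have h1 := hunrect _ (isC2Hypersurface_graph x₀ H hH hu hW hs)
  rw [← hd] at h1
  have hl : LipschitzWith 1 fun x => H.orthogonalProjectionOnto (x - x₀) := by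
    refine LipschitzWith.of_dist_le_mul fun x y => ?_
    rw [dist_eq_norm, ← map_sub, sub_sub_sub_cancel_right, NNReal.coe_one, one_mul, dist_eq_norm]
    exact H.norm_orthogonalProjectionOnto_apply_le _
  refine measure_mono_null ?_ (hl.hausdorffMeasure_image_eq_zero (Nat.cast_nonneg _) h1)
  rintro z ⟨hz, hzK⟩
  refine ⟨_, ⟨hzK, z, hz, rfl⟩, ?_⟩
  have h2 : x₀ + (z : EuclideanSpace ℝ (Fin n)) + s z • u - x₀ = z + s z • u := by abel
  dsimp only
  rw [h2, map_add, map_smul, Submodule.orthogonalProjectionOnto_apply_of_mem_orthogonal hu,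
    Submodule.orthogonalProjectionOnto_mem_subspace_eq_self, smul_zero, add_zero]

theorem false_of_differentiableAt_infDist_on_ball (hn : n ≠ 0) (hK : IsClosed K)
    (hne : K.Nonempty) (hsurf : IsC1Hypersurface K)
    (hunrect : ∀ M : Set (EuclideanSpace ℝ (Fin n)), IsC2Hypersurface M →
      μH[(n : ℝ) - 1] (K ∩ M) = 0)
    {x₀ : EuclideanSpace ℝ (Fin n)} {ρ : ℝ} (hρ : 0 < ρ) (hx₀K : x₀ ∉ K)
    (hd : ∀ x ∈ ball x₀ ρ, DifferentiableAt ℝ (fun y => infDist y K) x) : False := by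
  obtain ⟨a₀, ha₀, hx₀⟩ := hK.exists_infDist_eq_dist hne x₀
  have hxa : x₀ ≠ a₀ := fun h => hx₀K (h ▸ ha₀)
  have hr : 0 < ‖x₀ - a₀‖ := norm_pos_iff.2 (sub_ne_zero.2 hxa)
  set u := ‖x₀ - a₀‖⁻¹ • (x₀ - a₀) with hu
  have hu1 : ‖u‖ = 1 := by rw [hu, norm_smul, norm_inv, norm_norm, inv_mul_cancel₀ hr.ne']
  set H : Submodule ℝ (EuclideanSpace ℝ (Fin n)) := (ℝ ∙ u)ᗮ with hHdef
  have huH : u ∈ Hᗮ := by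
    rw [hHdef, Submodule.orthogonal_orthogonal]
    exact Submodule.mem_span_singleton_self u
  have hxH : x₀ - a₀ ∈ Hᗮ := by
    have : x₀ - a₀ = ‖x₀ - a₀‖ • u := by rw [hu, smul_inv_smul₀ hr.ne']
    rw [this]
    exact Hᗮ.smul_mem _ huH
  have hH : Module.finrank ℝ H = n - 1 := by
    have h1 := (ℝ ∙ u).finrank_add_finrank_orthogonal
    rw [finrank_span_singleton (norm_ne_zero_iff.1 (hu1 ▸ one_ne_zero)),
      finrank_euclideanSpace_fin, ← hHdef] at h1
    omega
  have hball : ∀ η : H, ‖η‖ < ρ → x₀ + H.subtypeₗᵢ η ∈ ball x₀ ρ := fun η hη => by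
    rw [mem_ball, dist_eq_norm, add_sub_cancel_left, LinearIsometry.norm_map]
    exact hη
  have hnear : ∀ η : H, ∃ a ∈ K, infDist (x₀ + H.subtypeₗᵢ η) K = dist (x₀ + H.subtypeₗᵢ η) a :=
    fun η => hK.exists_infDist_eq_dist hne _
  set g := distPotential K x₀ H.subtypeₗᵢ with hg
  have hconv : ConvexOn ℝ univ g := convexOn_of_forall_exists_isSubgradient fun η => by
    obtain ⟨a, ha, h⟩ := hnear η
    exact ⟨_, isSubgradient_distPotential ha h (inner_orthogonalProjectionOnto_apply H (a - x₀))⟩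
  obtain ⟨s, hs, hsub⟩ := exists_isSubgradient_of_lt_on_sphere hconv continuous_distPotential
    (half_pos hρ) fun η hη => distPotential_zero_lt hn hK hsurf ha₀ hx₀ hxa
      (hd x₀ (mem_ball_self hρ)) hxH (norm_ne_zero_iff.1 (hη ▸ (half_pos hρ).ne'))
      (hd _ (hball η (by linarith)))
  have hs' : 0 < min s ‖x₀ - a₀‖ := lt_min hs hr
  obtain ⟨W, h, hW, hh, hpos⟩ := exists_contDiffOn_conjugate hconv continuous_distPotential
    (isOpen_ball (x := (0 : H)) (ε := ρ / 2)) (measurableSet_ball (x := (0 : H)))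
    (fun z hz => by
      obtain ⟨η, hη, h⟩ := hsub z ((mem_ball_zero_iff.1 hz).trans_le (min_le_left _ _))
      exact ⟨η, mem_ball_zero_iff.2 hη, h⟩)
    (isOpen_ball.measure_ne_zero _ ⟨0, mem_ball_self hs'⟩)
  let q : H → ℝ := fun z => 2 * h z - ‖z‖ ^ 2
  have hq : ContDiffOn ℝ 2 q W :=
    (contDiffOn_const.mul hh).sub (contDiff_norm_sq ℝ).contDiffOn
  have hW' : IsOpen (W ∩ q ⁻¹' Ioi 0) := hq.continuousOn.isOpen_inter_preimage hW isOpen_Ioi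
  have hsqrt : ContDiffOn ℝ 2 (fun z => √(q z)) (W ∩ q ⁻¹' Ioi 0) :=
    (hq.mono inter_subset_left).sqrt fun z hz => (ne_of_gt hz.2)
  refine hpos (measure_mono_null ?_ (measure_union_null
    (hausdorffMeasure_graph_projection_eq_zero hunrect hn x₀ hH huH hW' hsqrt)
    (hausdorffMeasure_graph_projection_eq_zero hunrect hn x₀ hH huH hW' hsqrt.neg)))
  rintro z ⟨⟨hzW, hzS⟩, η, hη, hzη, hhz⟩
  obtain ⟨a, ha, hxa'⟩ := hnear η
  have hz : z = H.orthogonalProjectionOnto (a - x₀) :=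
    hzη.eq_of_differentiableAt
      (isSubgradient_distPotential ha hxa' (inner_orthogonalProjectionOnto_apply H (a - x₀)))
      (DifferentiableAt.distPotential
        (hd _ (hball η ((mem_ball_zero_iff.1 hη).trans (half_lt_self hρ)))))
  have hdec : a - x₀ = z + ⟪u, a - x₀⟫ • u := by
    conv_lhs => rw [eq_orthogonalProjectionOnto_add_inner_smul hu1 (a - x₀)]
    rw [hz]
  have hnorm : ‖a - x₀‖ ^ 2 = ‖z‖ ^ 2 + ⟪u, a - x₀⟫ ^ 2 := by
    conv_lhs => rw [hdec]
    have hzu : ⟪(z : EuclideanSpace ℝ (Fin n)), u⟫ = 0 := (Submodule.mem_orthogonal _ _).1 huH z z.2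
    rw [norm_add_sq_real, inner_smul_right, hzu, norm_smul, hu1, Real.norm_eq_abs, mul_one, sq_abs,
      Submodule.coe_norm]
    ring
  have hqz : q z = ⟪u, a - x₀⟫ ^ 2 := by
    simp only [q]
    rw [hhz, hg, distPotential_eq hxa', ← inner_orthogonalProjectionOnto_apply, ← hz]
    linarith
  have hqpos : 0 < q z := by
    have h1 : ‖x₀ - a₀‖ ≤ ‖a - x₀‖ := by
      rw [← dist_eq_norm, ← hx₀, ← dist_eq_norm, dist_comm]
      exact infDist_le_dist_of_mem ha
    have h2 : ‖z‖ < ‖a - x₀‖ :=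
      ((mem_ball_zero_iff.1 hzS).trans_le (min_le_right _ _)).trans_le h1
    have h3 := pow_lt_pow_left₀ h2 (norm_nonneg z) two_ne_zero
    rw [hqz]
    linarith
  have hax : a = x₀ + z + ⟪u, a - x₀⟫ • u := by
    rw [add_assoc, ← hdec, add_sub_cancel]
  have hsq : √(q z) = |⟪u, a - x₀⟫| := by rw [hqz, Real.sqrt_sq_eq_abs]
  rcases le_total 0 ⟪u, a - x₀⟫ with ht | ht
  · refine Or.inl ⟨⟨hzW, hqpos⟩, ?_⟩
    rw [hsq, abs_of_nonneg ht, ← hax]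
    exact ha
  · refine Or.inr ⟨⟨hzW, hqpos⟩, ?_⟩
    rw [hsq, abs_of_nonpos ht, neg_neg, ← hax]
    exact ha

end Main

open MeasureTheory in
/-- A closed connected `C^1`-hypersurface which is `C^2`-unrectifiable (it meets every
`C^2`-hypersurface in a set of `H^{n-1}`-measure zero) has singular set dense in `ℝ^n`. -/
theorem singular_set_dense_of_C2_unrectifiable {n : ℕ}
    (K : Set (EuclideanSpace ℝ (Fin n))) (hK : IsClosed K) (hconn : IsConnected K)
    (hsurf : IsC1Hypersurface K)
    (hunrect : ∀ M : Set (EuclideanSpace ℝ (Fin n)), IsC2Hypersurface M →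
      μH[(n : ℝ) - 1] (K ∩ M) = 0) :
    closure (singularSet K) = Set.univ := by
  rcases eq_or_ne n 0 with hn | hn
  · obtain ⟨a, ha⟩ := hconn.nonempty
    have h1 := hunrect univ (isC2Hypersurface_univ_of_eq_zero hn)
    have h2 : (μH[0] : Measure (EuclideanSpace ℝ (Fin n))) {a} = 0 :=
      nonpos_iff_eq_zero.1 ((Measure.hausdorffMeasure_mono (by simp [hn]) {a}).trans
        ((measure_mono (by simpa using ha)).trans_eq h1))
    rw [Measure.hausdorffMeasure_zero_singleton] at h2
    exact absurd h2 one_ne_zero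
  · by_contra hcl
    obtain ⟨y, hy⟩ := (ne_univ_iff_exists_notMem _).1 hcl
    have hO : IsOpen (closure (singularSet K))ᶜ := isClosed_closure.isOpen_compl
    have hne : ((closure (singularSet K))ᶜ \ K).Nonempty := by
      by_contra h
      rw [not_nonempty_iff_eq_empty, sdiff_eq_empty] at h
      have h2 : y ∈ interior K := interior_maximal h hO hy
      rw [hsurf.interior_eq_empty hn] at h2
      exact h2
    obtain ⟨x₀, hx₀⟩ := hne
    obtain ⟨ρ, hρ, hball⟩ := Metric.isOpen_iff.1 (hO.sdiff hK) x₀ hx₀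
    refine false_of_differentiableAt_infDist_on_ball hn hK hconn.nonempty hsurf hunrect hρ hx₀.2
      fun x hx => ?_
    by_contra hnd
    exact (hball hx).1 (subset_closure ⟨(hball hx).2, hnd⟩)
end

section
/- Let K ⊆ ℝ^n be a closed C^{1,1}-hypersurface. Then there exists an open neighborhood U of K in ℝ^n such that closure(Σ(K)) ∩ U = ∅. -/
open scoped NNReal in
/-- `σ` is a `C^{1,1}`-diffeomorphism from the open set `U` onto the open set `σ '' U`, with
inverse `τ`: both are `C^1` and their derivatives are locally Lipschitz. -/
def IsC11DiffeoOn {n : ℕ} (σ τ : EuclideanSpace ℝ (Fin n) → EuclideanSpace ℝ (Fin n))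
    (U : Set (EuclideanSpace ℝ (Fin n))) : Prop :=
  IsOpen (σ '' U) ∧ ContDiffOn ℝ 1 σ U ∧ ContDiffOn ℝ 1 τ (σ '' U) ∧
    (∀ x ∈ U, τ (σ x) = x) ∧ (∀ y ∈ σ '' U, σ (τ y) = y) ∧
    (∀ x ∈ U, ∃ s ∈ nhdsWithin x U, ∃ C : ℝ≥0, LipschitzOnWith C (fderiv ℝ σ) s) ∧
    (∀ y ∈ σ '' U, ∃ s ∈ nhdsWithin y (σ '' U), ∃ C : ℝ≥0, LipschitzOnWith C (fderiv ℝ τ) s)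

/-- `M ⊆ ℝ^n` is a `C^{1,1}`-hypersurface. -/
def IsC11Hypersurface {n : ℕ} (M : Set (EuclideanSpace ℝ (Fin n))) : Prop :=
  ∀ a ∈ M, ∃ U : Set (EuclideanSpace ℝ (Fin n)), IsOpen U ∧ a ∈ U ∧
    ∃ Z : Submodule ℝ (EuclideanSpace ℝ (Fin n)), Module.finrank ℝ Z = n - 1 ∧
      ∃ σ τ, IsC11DiffeoOn σ τ U ∧ σ '' (U ∩ M) = ↑Z ∩ σ '' U

/-- If `p` is the only nearest point of the closed set `K` to `x`, then nearest points to points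
close to `x` are close to `p`. -/
theorem eventually_nearest_mem_ball {E : Type*} [MetricSpace E] [ProperSpace E] {K : Set E}
    (hK : IsClosed K) {x p : E}
    (huniq : ∀ q ∈ K, dist x q = Metric.infDist x K → q = p) {ε : ℝ} (hε : 0 < ε) :
    ∀ᶠ y in nhds x, ∀ q ∈ K, dist y q = Metric.infDist y K → dist q p < ε := by
  rcases (K \ Metric.ball p ε).eq_empty_or_nonempty with hempty | hne
  · refine Filter.Eventually.of_forall fun y q hq _ => ?_
    by_contra hqp
    have : q ∈ K \ Metric.ball p ε := ⟨hq, hqp⟩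
    simp [hempty] at this
  · obtain ⟨z, hz, hzx⟩ := (hK.sdiff Metric.isOpen_ball).exists_infDist_eq_dist hne x
    have hlt : Metric.infDist x K < dist x z := by
      refine lt_of_le_of_ne (Metric.infDist_le_dist_of_mem hz.1) fun h => ?_
      have := huniq z hz.1 h.symm
      exact hz.2 (by simpa [this] using hε)
    have hball : Metric.ball x ((dist x z - Metric.infDist x K) / 2) ∈ nhds x :=
      Metric.ball_mem_nhds x (by linarith)
    filter_upwards [hball] with y hy q hq hyq
    by_contra hqp
    have hq' : q ∈ K \ Metric.ball p ε := ⟨hq, hqp⟩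
    have h1 : dist x z ≤ dist x q := hzx ▸ Metric.infDist_le_dist_of_mem hq'
    have h2 : dist x q ≤ dist x y + dist y q := dist_triangle _ _ _
    have h3 : Metric.infDist y K ≤ Metric.infDist x K + dist y x := Metric.infDist_le_infDist_add_dist
    rw [Metric.mem_ball] at hy
    rw [dist_comm x y] at h2
    linarith

/-- The squared distance function from a closed set is differentiable at each point with a
unique nearest point. -/
theorem hasFDerivAt_sq_infDist_of_unique_nearest {E : Type*} [NormedAddCommGroup E]
    [InnerProductSpace ℝ E] [ProperSpace E] {K : Set E} (hK : IsClosed K) {x p : E} (hp : p ∈ K)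
    (hxp : dist x p = Metric.infDist x K)
    (huniq : ∀ q ∈ K, dist x q = Metric.infDist x K → q = p) :
    HasFDerivAt (fun y => Metric.infDist y K ^ 2) ((2 : ℝ) • innerSL ℝ (x - p)) x := by
  rw [hasFDerivAt_iff_isLittleO, Asymptotics.isLittleO_iff]
  intro c hc
  filter_upwards [eventually_nearest_mem_ball hK huniq (by positivity : 0 < c / 2),
    Metric.ball_mem_nhds x hc] with y hy hyx
  obtain ⟨q, hq, hyq⟩ := hK.exists_infDist_eq_dist ⟨p, hp⟩ y
  have hqp := hy q hq hyq.symm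
  have hup : Metric.infDist y K ≤ dist y p := Metric.infDist_le_dist_of_mem hp
  have hlow : Metric.infDist x K ≤ dist x q := Metric.infDist_le_dist_of_mem hq
  have hup2 : Metric.infDist y K ^ 2 ≤ ‖y - p‖ ^ 2 := by
    rw [← dist_eq_norm]; exact pow_le_pow_left₀ Metric.infDist_nonneg hup 2
  have hlow2 : Metric.infDist x K ^ 2 ≤ ‖x - q‖ ^ 2 := by
    rw [← dist_eq_norm]; exact pow_le_pow_left₀ Metric.infDist_nonneg hlow 2
  have hx2 : Metric.infDist x K ^ 2 = ‖x - p‖ ^ 2 := by rw [← hxp, dist_eq_norm]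
  have hy2 : Metric.infDist y K ^ 2 = ‖y - q‖ ^ 2 := by rw [hyq, dist_eq_norm]
  have e1 : ‖y - p‖ ^ 2 = ‖y - x‖ ^ 2 + 2 * inner ℝ (x - p) (y - x) + ‖x - p‖ ^ 2 := by
    rw [show y - p = (y - x) + (x - p) by abel, norm_add_sq_real, real_inner_comm]
  have e2 : ‖y - q‖ ^ 2 = ‖y - x‖ ^ 2 + 2 * (inner ℝ (x - p) (y - x) + inner ℝ (p - q) (y - x))
      + ‖x - q‖ ^ 2 := by
    rw [← inner_add_left, show (x - p) + (p - q) = x - q by abel,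
      show y - q = (y - x) + (x - q) by abel, norm_add_sq_real, real_inner_comm]
  have hcs : |inner ℝ (p - q) (y - x)| ≤ ‖p - q‖ * ‖y - x‖ := abs_real_inner_le_norm _ _
  rw [Metric.mem_ball, dist_eq_norm] at hyx
  rw [dist_comm, dist_eq_norm] at hqp
  have hn := norm_nonneg (y - x)
  have h5 : ‖p - q‖ * ‖y - x‖ ≤ c / 2 * ‖y - x‖ := by gcongr
  have h6 : ‖y - x‖ ^ 2 ≤ c * ‖y - x‖ := by nlinarith
  have h7 := abs_le.1 hcs
  rw [Real.norm_eq_abs, abs_le]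
  simp only [FunLike.coe_smul, Pi.smul_apply, innerSL_apply_apply, smul_eq_mul]
  constructor <;> nlinarith [sq_nonneg ‖y - x‖]

/-- The distance function from a closed set `K` is differentiable at each point outside `K` with
a unique nearest point. -/
theorem differentiableAt_infDist_of_unique_nearest {E : Type*} [NormedAddCommGroup E]
    [InnerProductSpace ℝ E] [ProperSpace E] {K : Set E} (hK : IsClosed K) {x p : E} (hx : x ∉ K)
    (hp : p ∈ K) (hxp : dist x p = Metric.infDist x K)
    (huniq : ∀ q ∈ K, dist x q = Metric.infDist x K → q = p) :
    DifferentiableAt ℝ (fun y => Metric.infDist y K) x := by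
  have hpos : 0 < Metric.infDist x K := (hK.notMem_iff_infDist_pos ⟨p, hp⟩).1 hx
  have h := (hasFDerivAt_sq_infDist_of_unique_nearest hK hp hxp huniq).differentiableAt.sqrt
    (pow_pos hpos 2).ne'
  simpa only [Real.sqrt_sq Metric.infDist_nonneg] using h

/-- First-order Taylor estimate for a function with Lipschitz derivative on a convex set. -/
theorem norm_sub_sub_fderiv_le_of_lipschitzOnWith {E F : Type*} [NormedAddCommGroup E]
    [NormedSpace ℝ E] [NormedAddCommGroup F] [NormedSpace ℝ F] {f : E → F} {s : Set E}
    {C : NNReal} (hs : Convex ℝ s) (hf : ∀ z ∈ s, DifferentiableAt ℝ f z)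
    (hC : LipschitzOnWith C (fderiv ℝ f) s) {u v : E} (hu : u ∈ s) (hv : v ∈ s) :
    ‖f v - f u - fderiv ℝ f u (v - u)‖ ≤ C * ‖v - u‖ ^ 2 := by
  have hseg : segment ℝ u v ⊆ s := hs.segment_subset hu hv
  have h := (convex_segment u v).norm_image_sub_le_of_norm_fderiv_le' (𝕜 := ℝ) (f := f)
    (φ := fderiv ℝ f u) (C := C * ‖v - u‖) (fun z hz => hf z (hseg hz)) (fun z hz => ?_)
    (left_mem_segment ℝ u v) (right_mem_segment ℝ u v)
  · simpa only [sq, mul_assoc] using h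
  · refine (hC.norm_sub_le (hseg hz) hu).trans ?_
    gcongr
    have := segment_subset_closedBall_left u v hz
    rwa [Metric.mem_closedBall, dist_eq_norm, dist_comm, dist_eq_norm] at this

/-- If `τ` maps the segment `[u, v]` into `K` and `τ u` is nearest to `x` in `K`, then the velocity
at `τ u` does not point towards `x`. -/
theorem inner_fderiv_nonpos_of_nearest {E F : Type*} [NormedAddCommGroup E] [NormedSpace ℝ E]
    [NormedAddCommGroup F] [InnerProductSpace ℝ F] {K : Set F} {τ : E → F} {u v : E} {x : F}
    (hτ : DifferentiableAt ℝ τ u) (hseg : ∀ z ∈ segment ℝ u v, τ z ∈ K)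
    (hx : dist x (τ u) = Metric.infDist x K) :
    inner ℝ (x - τ u) (fderiv ℝ τ u (v - u)) ≤ 0 := by
  have hmin : IsLocalMinOn (fun z => ‖x - τ z‖ ^ 2) (segment ℝ u v) u := by
    refine IsMinOn.localize fun z hz => ?_
    have := hx.trans_le (Metric.infDist_le_dist_of_mem (hseg z hz))
    rw [dist_eq_norm, dist_eq_norm] at this
    exact pow_le_pow_left₀ (norm_nonneg _) this 2
  have h := hmin.hasFDerivWithinAt_nonneg
    ((hτ.hasFDerivAt.const_sub x).norm_sq).hasFDerivWithinAt
    (sub_mem_posTangentConeAt_of_segment_subset subset_rfl)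
  rw [inner_sub_left, map_sub]
  simpa using h

/-- Near a point of a `C^{1,1}`-hypersurface, the hypersurface is locally of positive reach. -/
theorem IsC11Hypersurface.exists_inner_le {n : ℕ} {K : Set (EuclideanSpace ℝ (Fin n))}
    (hK : IsC11Hypersurface K) {a : EuclideanSpace ℝ (Fin n)} (ha : a ∈ K) :
    ∃ ρ > 0, ∃ M : ℝ, 0 ≤ M ∧ ∀ x, ∀ p ∈ K ∩ Metric.ball a ρ, ∀ q ∈ K ∩ Metric.ball a ρ,
      dist x p = Metric.infDist x K → inner ℝ (x - p) (q - p) ≤ M * ‖x - p‖ * ‖q - p‖ ^ 2 := by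
  obtain ⟨U, hU, haU, Z, -, σ, τ, ⟨hV, hσ, hτ, hτσ, hστ, -, hlip⟩, himage⟩ := hK a ha
  have hσa : σ a ∈ σ '' U := Set.mem_image_of_mem σ haU
  obtain ⟨s, hs, C, hC⟩ := hlip (σ a) hσa
  rw [hV.nhdsWithin_eq hσa] at hs
  obtain ⟨ε, hε, hball⟩ := Metric.mem_nhds_iff.1 (Filter.inter_mem hs (hV.mem_nhds hσa))
  have hσat : ContDiffAt ℝ 1 σ a := hσ.contDiffAt (hU.mem_nhds haU)
  obtain ⟨L, t, ht, hL⟩ := hσat.exists_lipschitzOnWith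
  obtain ⟨ρ, hρ, hρball⟩ := Metric.mem_nhds_iff.1 (Filter.inter_mem
    (Filter.inter_mem ht (hU.mem_nhds haU))
    (hσat.continuousAt.preimage_mem_nhds (Metric.ball_mem_nhds (σ a) hε)))
  refine ⟨ρ, hρ, C * L ^ 2, by positivity, ?_⟩
  rintro x p ⟨hpK, hpρ⟩ q ⟨hqK, hqρ⟩ hxp
  obtain ⟨⟨hpt, hpU⟩, hpσ⟩ := hρball hpρ
  obtain ⟨⟨hqt, hqU⟩, hqσ⟩ := hρball hqρ
  have hpZ : σ p ∈ (Z : Set _) := (himage.subset (Set.mem_image_of_mem σ ⟨hpU, hpK⟩)).1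
  have hqZ : σ q ∈ (Z : Set _) := (himage.subset (Set.mem_image_of_mem σ ⟨hqU, hqK⟩)).1
  have hdiff : ∀ z ∈ Metric.ball (σ a) ε, DifferentiableAt ℝ τ z := fun z hz =>
    (hτ.contDiffAt (hV.mem_nhds (hball hz).2)).differentiableAt one_ne_zero
  have hseg : ∀ z ∈ segment ℝ (σ p) (σ q), τ z ∈ K := by
    intro z hz
    have hzZ : z ∈ (Z : Set _) := Z.convex.segment_subset hpZ hqZ hz
    have hzV := (hball ((convex_ball (σ a) ε).segment_subset hpσ hqσ hz)).2
    obtain ⟨y, ⟨hyU, hyK⟩, rfl⟩ := himage.superset ⟨hzZ, hzV⟩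
    rwa [hτσ y hyU]
  have hnonpos := inner_fderiv_nonpos_of_nearest (x := x) (hdiff _ hpσ) hseg
    (by rwa [hτσ p hpU])
  have htaylor := norm_sub_sub_fderiv_le_of_lipschitzOnWith (convex_ball (σ a) ε) hdiff
    (hC.mono fun z hz => (hball hz).1) hpσ hqσ
  rw [hτσ p hpU] at hnonpos htaylor
  rw [hτσ q hqU] at htaylor
  have hLpq := hL.norm_sub_le hqt hpt
  set D := fderiv ℝ τ (σ p) (σ q - σ p)
  calc inner ℝ (x - p) (q - p)
      = inner ℝ (x - p) (q - p - D) + inner ℝ (x - p) D := by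
        rw [← inner_add_right, sub_add_cancel]
    _ ≤ ‖x - p‖ * ‖q - p - D‖ := by linarith [real_inner_le_norm (x - p) (q - p - D)]
    _ ≤ ‖x - p‖ * (C * (L * ‖q - p‖) ^ 2) := by
        gcongr
        exact htaylor.trans (by gcongr)
    _ = C * L ^ 2 * ‖x - p‖ * ‖q - p‖ ^ 2 := by ring

/-- Near a point of a closed `C^{1,1}`-hypersurface there are no singular points of the
distance function. -/
theorem IsC11Hypersurface.exists_ball_disjoint_singularSet {n : ℕ}
    {K : Set (EuclideanSpace ℝ (Fin n))} (hK : IsClosed K) (hsurf : IsC11Hypersurface K)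
    {a : EuclideanSpace ℝ (Fin n)} (ha : a ∈ K) :
    ∃ r > 0, Disjoint (singularSet K) (Metric.ball a r) := by
  obtain ⟨ρ, hρ, M, hM, hreach⟩ := hsurf.exists_inner_le ha
  refine ⟨min (ρ / 2) (1 / (2 * M + 1)), by positivity, Set.disjoint_left.2 ?_⟩
  rintro x ⟨hxK, hndiff⟩ hxa
  rw [Metric.mem_ball, lt_min_iff] at hxa
  have hxM := (lt_div_iff₀ (by positivity)).1 hxa.2
  have hnear : ∀ q ∈ K, dist x q = Metric.infDist x K → q ∈ K ∩ Metric.ball a ρ := by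
    intro q hq hxq
    have h1 : dist x q ≤ dist x a := hxq.trans_le (Metric.infDist_le_dist_of_mem ha)
    have h2 := dist_triangle_left q a x
    have h3 := hxa.1
    exact ⟨hq, Metric.mem_ball.2 (by linarith)⟩
  obtain ⟨p, hp, hxp⟩ := hK.exists_infDist_eq_dist ⟨a, ha⟩ x
  refine hndiff (differentiableAt_infDist_of_unique_nearest hK hxK hp hxp.symm fun q hq hxq => ?_)
  have h := hreach x p (hnear p hp hxp.symm) q (hnear q hq hxq) hxp.symm
  have hd : ‖x - p‖ ≤ dist x a := by
    rw [← dist_eq_norm, ← hxp]; exact Metric.infDist_le_dist_of_mem ha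
  have heq : ‖x - q‖ = ‖x - p‖ := by
    rw [← dist_eq_norm, ← dist_eq_norm, hxq, hxp]
  have hexp : ‖x - q‖ ^ 2 = ‖x - p‖ ^ 2 - 2 * inner ℝ (x - p) (q - p) + ‖q - p‖ ^ 2 := by
    rw [← norm_sub_sq_real, sub_sub_sub_cancel_right]
  rw [heq] at hexp
  have hsmall : 2 * M * ‖x - p‖ < 1 := by nlinarith [norm_nonneg (x - p)]
  by_contra hne
  have hpos : 0 < ‖q - p‖ ^ 2 := pow_pos (norm_pos_iff.2 (sub_ne_zero.2 hne)) 2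
  nlinarith

/-- A closed `C^{1,1}`-hypersurface `K` has an open neighbourhood `U` disjoint from the closure
of its singular set `Σ(K)`. -/
theorem closure_singular_set_disjoint_neighborhood_of_C11 {n : ℕ}
    (K : Set (EuclideanSpace ℝ (Fin n))) (hK : IsClosed K) (hsurf : IsC11Hypersurface K) :
    ∃ U : Set (EuclideanSpace ℝ (Fin n)), IsOpen U ∧ K ⊆ U ∧
      closure (singularSet K) ∩ U = ∅ := by
  choose! r hr hdisj using fun a (ha : a ∈ K) => hsurf.exists_ball_disjoint_singularSet hK ha
  refine ⟨⋃ a ∈ K, Metric.ball a (r a), isOpen_biUnion fun a _ => Metric.isOpen_ball,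
    fun a ha => Set.mem_biUnion ha (Metric.mem_ball_self (hr a ha)), ?_⟩
  rw [← Set.disjoint_iff_inter_eq_empty]
  exact (Set.disjoint_iUnion₂_right.2 hdisj).closure_left
    (isOpen_biUnion fun a _ => Metric.isOpen_ball)
end

section
/- Let C ⊆ ℝ^n be a convex body and let ε > 0. Define C_ε = {x ∈ ℝ^n : δ_C(x) ≤ ε}. Then C_ε is a convex body, its boundary ∂C_ε is a C^{1,1}-hypersurface, and Σ(∂C) ⊆ Σ(∂C_ε). -/
section ConvexProjection

variable {E : Type*} [NormedAddCommGroup E] [InnerProductSpace ℝ E]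

lemma infDist_eq_norm_of_inner_nonpos {C : Set E} {x p : E} (hconv : Convex ℝ C) (hp : p ∈ C)
    (h : ∀ c ∈ C, inner ℝ (x - p) (c - p) ≤ 0) : Metric.infDist x C = ‖x - p‖ := by
  rw [(norm_eq_iInf_iff_real_inner_le_zero hconv hp).2 h, Metric.infDist_eq_iInf]
  simp only [dist_eq_norm]

/-- The displacement `x ↦ x - π x`, where `π` is the nearest point projection onto `C`. -/
lemma exists_projection_displacement [CompleteSpace E] {C : Set E} (hne : C.Nonempty)
    (hcl : IsClosed C) (hconv : Convex ℝ C) :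
    ∃ g : E → E, (∀ x, x - g x ∈ C) ∧
      ∀ x, ∀ c ∈ C, inner ℝ (g x) (c - (x - g x)) ≤ 0 := by
  choose p hp hp' using exists_norm_eq_iInf_of_complete_convex hne hcl.isComplete hconv
  refine ⟨fun x => x - p x, fun x => by simpa using hp x, fun x c hc => ?_⟩
  simpa using (norm_eq_iInf_iff_real_inner_le_zero hconv (hp x)).1 (hp' x) c hc

variable {C : Set E} {g : E → E}

lemma norm_projection_displacement (hconv : Convex ℝ C) (hg : ∀ x, x - g x ∈ C)
    (hin : ∀ x, ∀ c ∈ C, inner ℝ (g x) (c - (x - g x)) ≤ 0) (x : E) :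
    Metric.infDist x C = ‖g x‖ := by
  rw [infDist_eq_norm_of_inner_nonpos hconv (hg x) (fun c hc => by simpa using hin x c hc)]
  simp

lemma norm_sq_le_inner_projection_displacement (hg : ∀ x, x - g x ∈ C)
    (hin : ∀ x, ∀ c ∈ C, inner ℝ (g x) (c - (x - g x)) ≤ 0) (x y : E) :
    ‖g y - g x‖ ^ 2 ≤ inner ℝ (g y - g x) (y - x) := by
  have h1 := hin x _ (hg y)
  have h2 := hin y _ (hg x)
  rw [← real_inner_self_eq_norm_sq]
  simp only [inner_sub_left, inner_sub_right] at *
  linarith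

lemma lipschitzWith_projection_displacement (hg : ∀ x, x - g x ∈ C)
    (hin : ∀ x, ∀ c ∈ C, inner ℝ (g x) (c - (x - g x)) ≤ 0) : LipschitzWith 1 g := by
  refine LipschitzWith.of_dist_le_mul fun y x => ?_
  have h := (norm_sq_le_inner_projection_displacement hg hin x y).trans (real_inner_le_norm _ _)
  rw [dist_eq_norm, dist_eq_norm, NNReal.coe_one, one_mul]
  by_contra! hlt
  nlinarith [norm_nonneg (y - x)]

lemma hasFDerivAt_half_infDist_sq (hconv : Convex ℝ C) (hg : ∀ x, x - g x ∈ C)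
    (hin : ∀ x, ∀ c ∈ C, inner ℝ (g x) (c - (x - g x)) ≤ 0) (x : E) :
    HasFDerivAt (fun y => Metric.infDist y C ^ 2 / 2) (innerSL ℝ (g x)) x := by
  have upper : ∀ x y, Metric.infDist y C ^ 2 / 2 ≤
      Metric.infDist x C ^ 2 / 2 + inner ℝ (g x) (y - x) + ‖y - x‖ ^ 2 / 2 := by
    intro x y
    have h : Metric.infDist y C ≤ ‖g x + (y - x)‖ := by
      refine (Metric.infDist_le_dist_of_mem (hg x)).trans_eq ?_
      rw [dist_eq_norm]
      congr 1
      abel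
    have h2 := pow_le_pow_left₀ Metric.infDist_nonneg h 2
    rw [norm_add_sq_real, ← norm_projection_displacement hconv hg hin] at h2
    linarith
  rw [hasFDerivAt_iff_isLittleO]
  refine Asymptotics.IsBigO.trans_isLittleO (g := fun y => ‖y - x‖ ^ 2)
    (Asymptotics.IsBigO.of_bound 1 (Filter.Eventually.of_forall fun y => ?_))
    (Asymptotics.isLittleO_pow_sub_sub x one_lt_two)
  have h1 := upper x y
  have h2 := upper y x
  have h3 := norm_sq_le_inner_projection_displacement hg hin x y
  have h4 : inner ℝ (g y) (x - y) = - inner ℝ (g y) (y - x) := by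
    rw [← inner_neg_right, neg_sub]
  rw [inner_sub_left] at h3
  rw [norm_sub_rev x y] at h2
  simp only [innerSL_apply_apply, Real.norm_eq_abs, abs_pow, abs_norm, one_mul]
  rw [abs_le]
  constructor <;> nlinarith [sq_nonneg ‖y - x‖, sq_nonneg ‖g y - g x‖]

lemma infDist_projection_displacement_add (hconv : Convex ℝ C) {p v : E} (hp : p ∈ C)
    (hv : ∀ c ∈ C, inner ℝ v (c - p) ≤ 0) : Metric.infDist (p + v) C = ‖v‖ := by
  simpa using infDist_eq_norm_of_inner_nonpos (x := p + v) hconv hp (by simpa using hv)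

lemma frontier_infDist_le [CompleteSpace E] (hne : C.Nonempty) (hcl : IsClosed C)
    (hconv : Convex ℝ C) {ε : ℝ} (hε : 0 < ε) :
    frontier {x | Metric.infDist x C ≤ ε} = {x | Metric.infDist x C = ε} := by
  refine (frontier_le_subset_eq (Metric.continuous_infDist_pt C) continuous_const).antisymm ?_
  obtain ⟨g, hg, hin⟩ := exists_projection_displacement hne hcl hconv
  intro x hx
  rw [Set.mem_ofPred_eq] at hx
  refine ⟨subset_closure hx.le, fun hxi => ?_⟩
  have hray : ∀ t : ℝ, 0 ≤ t → Metric.infDist (x + t • g x) C = (1 + t) * ε := by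
    intro t ht
    have h := infDist_projection_displacement_add hconv (v := (1 + t) • g x) (hg x) fun c hc => by
      rw [inner_smul_left]
      exact mul_nonpos_of_nonneg_of_nonpos (by simp; linarith) (hin x c hc)
    rw [norm_smul, ← norm_projection_displacement hconv hg hin, hx, Real.norm_eq_abs,
      abs_of_nonneg (by linarith)] at h
    rw [← h]
    congr 1
    module
  have hlim : Filter.Tendsto (fun t : ℝ => x + t • g x) (nhdsWithin 0 (Set.Ioi 0)) (nhds x) := by
    have : Continuous fun t : ℝ => x + t • g x := by fun_prop
    simpa using (this.tendsto 0).mono_left nhdsWithin_le_nhds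
  obtain ⟨t, ht, ht0⟩ := ((hlim.eventually (mem_interior_iff_mem_nhds.1 hxi)).and
    self_mem_nhdsWithin).exists
  have h : Metric.infDist (x + t • g x) C ≤ ε := ht
  rw [hray t (le_of_lt ht0)] at h
  nlinarith [show (0 : ℝ) < t from ht0]

lemma differentiableAt_infDist_of_notMem [CompleteSpace E] (hne : C.Nonempty)
    (hcl : IsClosed C) (hconv : Convex ℝ C) {x : E} (hx : x ∉ C) :
    DifferentiableAt ℝ (fun y => Metric.infDist y C) x := by
  obtain ⟨g, hg, hin⟩ := exists_projection_displacement hne hcl hconv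
  have hpos := (hcl.notMem_iff_infDist_pos hne).1 hx
  have h := ((hasFDerivAt_half_infDist_sq hconv hg hin x).const_mul 2).sqrt (by positivity)
  refine h.differentiableAt.congr_of_eventuallyEq (Filter.Eventually.of_forall fun y => ?_)
  simp only
  rw [mul_div_cancel₀ _ two_ne_zero, Real.sqrt_sq Metric.infDist_nonneg]

end ConvexProjection

section Frontier

lemma IsPreconnected.inter_frontier_nonempty {α : Type*} [TopologicalSpace α] {s C : Set α}
    (hs : IsPreconnected s) (h1 : (s ∩ C).Nonempty) (h2 : (s ∩ Cᶜ).Nonempty) :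
    (s ∩ frontier C).Nonempty := by
  by_contra hf
  rw [Set.not_nonempty_iff_eq_empty, ← Set.disjoint_iff_inter_eq_empty,
    Set.disjoint_left] at hf
  obtain ⟨x, hxs, hx⟩ := h1
  obtain ⟨y, hys, hy⟩ := h2
  have hsub : s ⊆ interior C := by
    refine hs.subset_of_closure_inter_subset isOpen_interior
      ⟨x, hxs, by_contra fun h => hf hxs ⟨subset_closure hx, h⟩⟩ fun z hz => ?_
    exact by_contra fun h => hf hz.2 ⟨closure_mono interior_subset hz.1, h⟩
  exact hy (interior_subset (hsub hys))

variable {E : Type*} [NormedAddCommGroup E] [NormedSpace ℝ E]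

lemma exists_mem_frontier_dist_add_dist {C : Set E} {x y : E} (hx : x ∈ C) (hy : y ∉ C) :
    ∃ p ∈ frontier C, dist x p + dist p y = dist x y := by
  obtain ⟨p, hps, hp⟩ := (convex_segment (𝕜 := ℝ) x y).isPreconnected.inter_frontier_nonempty
    ⟨x, left_mem_segment ℝ x y, hx⟩ ⟨y, right_mem_segment ℝ x y, hy⟩
  exact ⟨p, hp, dist_add_dist_of_mem_segment hps⟩

lemma infDist_frontier_of_notMem {C : Set E} (hne : C.Nonempty) (hcl : IsClosed C) {x : E}
    (hx : x ∉ C) : Metric.infDist x (frontier C) = Metric.infDist x C := by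
  have hfr : (frontier C).Nonempty := by
    obtain ⟨c, hc⟩ := hne
    obtain ⟨p, hp, -⟩ := exists_mem_frontier_dist_add_dist hc hx
    exact ⟨p, hp⟩
  refine le_antisymm ?_ (Metric.infDist_le_infDist_of_subset hcl.frontier_subset hfr)
  rw [Metric.le_infDist hne]
  intro c hc
  obtain ⟨p, hp, hd⟩ := exists_mem_frontier_dist_add_dist hc hx
  have := Metric.infDist_le_dist_of_mem (x := x) hp
  rw [dist_comm x c, ← hd]
  rw [dist_comm x p] at this
  linarith [dist_nonneg (x := c) (y := p)]

end Frontier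

section ParallelBody

variable {E : Type*} [NormedAddCommGroup E] [InnerProductSpace ℝ E] [CompleteSpace E]

lemma exists_unit_outer_normal {C : Set E} (hconv : Convex ℝ C) (hint : (interior C).Nonempty)
    {p : E} (hp : p ∉ interior C) :
    ∃ v : E, ‖v‖ = 1 ∧ ∀ c ∈ C, inner ℝ v (c - p) ≤ 0 := by
  obtain ⟨f, hf⟩ := geometric_hahn_banach_open_point hconv.interior isOpen_interior hp
  set w := (InnerProductSpace.toDual ℝ E).symm f with hw
  have hwf : ∀ y, inner ℝ w y = f y := fun y => InnerProductSpace.toDual_symm_apply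
  have hw0 : w ≠ 0 := by
    intro h0
    obtain ⟨a, ha⟩ := hint
    have h := hf a ha
    simp [← hwf, h0] at h
  refine ⟨‖w‖⁻¹ • w, by simp [norm_smul, hw0], fun c hc => ?_⟩
  have hle : f c ≤ f p := by
    have hc' : c ∈ closure (interior C) := by
      rw [hconv.closure_interior_eq_closure_of_nonempty_interior hint]
      exact subset_closure hc
    exact closure_minimal (t := {y | f y ≤ f p}) (fun a ha => (hf a ha).le)
      (isClosed_le f.continuous continuous_const) hc'
  rw [inner_smul_left, hwf, map_sub]
  exact mul_nonpos_of_nonneg_of_nonpos (by simp) (by linarith)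

lemma infDist_frontier_parallel {C : Set E} (hcl : IsClosed C) (hconv : Convex ℝ C)
    (hint : (interior C).Nonempty) {ε : ℝ} (hε : 0 < ε) (hfr : (frontier C).Nonempty)
    {x : E} (hx : x ∈ C) :
    Metric.infDist x (frontier {y | Metric.infDist y C ≤ ε}) =
      Metric.infDist x (frontier C) + ε := by
  have hne : C.Nonempty := ⟨x, hx⟩
  rw [frontier_infDist_le hne hcl hconv hε]
  have key : ∀ p ∈ frontier C, ∃ q, Metric.infDist q C = ε ∧ dist x q ≤ dist x p + ε := by
    intro p hp
    obtain ⟨v, hv, hvC⟩ := exists_unit_outer_normal hconv hint hp.2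
    refine ⟨p + ε • v, ?_, ?_⟩
    · rw [infDist_projection_displacement_add hconv (hcl.frontier_subset hp), norm_smul, hv,
        Real.norm_eq_abs, abs_of_pos hε, mul_one]
      intro c hc
      rw [inner_smul_left]
      exact mul_nonpos_of_nonneg_of_nonpos (by simpa using hε.le) (hvC c hc)
    · refine (dist_triangle x p _).trans_eq ?_
      simp [norm_smul, hv, abs_of_pos hε]
  apply le_antisymm
  · rw [← sub_le_iff_le_add, Metric.le_infDist hfr]
    intro p hp
    obtain ⟨q, hq, hd⟩ := key p hp
    linarith [Metric.infDist_le_dist_of_mem (x := x) (s := {y | Metric.infDist y C = ε}) hq]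
  · obtain ⟨p, hp⟩ := hfr
    obtain ⟨q, hq, -⟩ := key p hp
    rw [Metric.le_infDist ⟨q, hq⟩]
    intro y hy
    have hyC : y ∉ C := by
      rw [hcl.notMem_iff_infDist_pos hne]
      exact hε.trans_eq (Eq.symm hy)
    obtain ⟨r, hr, hd⟩ := exists_mem_frontier_dist_add_dist hx hyC
    have h1 := Metric.infDist_le_dist_of_mem (x := x) hr
    have h2 := Metric.infDist_le_dist_of_mem (x := y) (hcl.frontier_subset hr)
    rw [Set.mem_ofPred_eq] at hy
    rw [dist_comm] at h2
    linarith

end ParallelBody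

open scoped NNReal in
lemma exists_isC11DiffeoOn {n : ℕ} {σ : EuclideanSpace ℝ (Fin n) → EuclideanSpace ℝ (Fin n)}
    {K : ℝ≥0} (hσ : ContDiff ℝ 1 σ) (hK : LipschitzWith K (fderiv ℝ σ))
    {a : EuclideanSpace ℝ (Fin n)} (ha : fderiv ℝ σ a = ContinuousLinearMap.id ℝ _) :
    ∃ U, IsOpen U ∧ a ∈ U ∧ ∃ τ, IsC11DiffeoOn σ τ U := by
  have hd : ∀ x, HasFDerivAt σ (fderiv ℝ σ x) x := fun x =>
    (hσ.differentiable one_ne_zero x).hasFDerivAt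
  have hda : HasFDerivAt σ ((ContinuousLinearEquiv.refl ℝ (EuclideanSpace ℝ (Fin n)) :
      EuclideanSpace ℝ (Fin n) ≃L[ℝ] EuclideanSpace ℝ (Fin n)) :
      EuclideanSpace ℝ (Fin n) →L[ℝ] EuclideanSpace ℝ (Fin n)) a := by
    have h := hd a
    rw [ha] at h
    exact h
  set φ := hσ.contDiffAt.toOpenPartialHomeomorph σ hda one_ne_zero with hφ
  have hφσ : ∀ x, φ x = σ x := fun x => rfl
  set U := φ.source ∩ {x | IsUnit (fderiv ℝ σ x)} with hU
  have hUo : IsOpen U := φ.open_source.inter (Units.isOpen.preimage hK.continuous)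
  have haU : a ∈ U := by
    refine ⟨hσ.contDiffAt.mem_toOpenPartialHomeomorph_source hda one_ne_zero, ?_⟩
    rw [Set.mem_ofPred_eq, ha]
    exact isUnit_one
  have hVo : IsOpen (σ '' U) := φ.isOpen_image_of_subset_source hUo Set.inter_subset_left
  have hleft : ∀ x ∈ U, φ.symm (σ x) = x := fun x hx => φ.left_inv hx.1
  have hmaps : ∀ y ∈ σ '' U, φ.symm y ∈ U := by
    rintro _ ⟨x, hx, rfl⟩
    rwa [hleft x hx]
  have hright : ∀ y ∈ σ '' U, σ (φ.symm y) = y := by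
    rintro _ ⟨x, hx, rfl⟩
    rw [hleft x hx]
  have htgt : ∀ y ∈ σ '' U, y ∈ φ.target := by
    rintro _ ⟨x, hx, rfl⟩
    exact φ.map_source hx.1
  have hequiv : ∀ y ∈ σ '' U, ∃ e : EuclideanSpace ℝ (Fin n) ≃L[ℝ] EuclideanSpace ℝ (Fin n),
      (e : EuclideanSpace ℝ (Fin n) →L[ℝ] EuclideanSpace ℝ (Fin n)) = fderiv ℝ σ (φ.symm y) := by
    intro y hy
    obtain ⟨u, hu⟩ := (hmaps y hy).2
    exact ⟨ContinuousLinearEquiv.unitsEquiv ℝ _ u, by rw [← hu]; rfl⟩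
  have hsmooth : ∀ y ∈ σ '' U, ContDiffAt ℝ 1 φ.symm y := by
    intro y hy
    obtain ⟨e, he⟩ := hequiv y hy
    exact φ.contDiffAt_symm (f₀' := e) (htgt y hy) (by rw [he]; exact hd _) hσ.contDiffAt
  have hfd : ∀ y ∈ σ '' U, fderiv ℝ φ.symm y = Ring.inverse (fderiv ℝ σ (φ.symm y)) := by
    intro y hy
    obtain ⟨e, he⟩ := hequiv y hy
    rw [(φ.hasFDerivAt_symm (f' := e) (htgt y hy) (by rw [he]; exact hd _)).fderiv, ← he,
      ContinuousLinearMap.ringInverse_equiv, ContinuousLinearMap.inverse_equiv]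
  refine ⟨U, hUo, haU, φ.symm, hVo, hσ.contDiffOn,
    fun y hy => (hsmooth y hy).contDiffWithinAt, hleft, hright,
    fun x _ => ⟨Set.univ, Filter.univ_mem, K, hK.lipschitzOnWith⟩, fun y hy => ?_⟩
  obtain ⟨K₁, s, hs, hK₁⟩ := (hsmooth y hy).exists_lipschitzOnWith
  obtain ⟨u, hu⟩ := (hmaps y hy).2
  obtain ⟨K₂, t, ht, hK₂⟩ := (contDiffAt_ringInverse ℝ (n := 1) u).exists_lipschitzOnWith
  have hcont : ContinuousAt (fun z => fderiv ℝ σ (φ.symm z)) y :=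
    hK.continuous.continuousAt.comp (hsmooth y hy).continuousAt
  have hpre : (fun z => fderiv ℝ σ (φ.symm z)) ⁻¹' t ∈ nhds y := hcont (by rwa [hu] at ht)
  refine ⟨s ∩ (fun z => fderiv ℝ σ (φ.symm z)) ⁻¹' t ∩ σ '' U,
    mem_nhdsWithin_of_mem_nhds
      (Filter.inter_mem (Filter.inter_mem hs hpre) (hVo.mem_nhds hy)), K₂ * (K * K₁), ?_⟩
  have h := hK₂.comp ((hK.lipschitzOnWith (s := Set.univ)).comp hK₁ (Set.mapsTo_univ _ _)
    |>.mono (Set.inter_subset_left (t := (fun z => fderiv ℝ σ (φ.symm z)) ⁻¹' t)))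
    (fun z hz => hz.2)
  intro z hz w hw
  rw [hfd z hz.2, hfd w hw.2]
  exact h hz.1 hw.1

lemma isC11Hypersurface_setOf_infDist_eq {n : ℕ} {C : Set (EuclideanSpace ℝ (Fin n))}
    (hne : C.Nonempty) (hcl : IsClosed C) (hconv : Convex ℝ C) {ε : ℝ} (hε : 0 < ε) :
    IsC11Hypersurface {x | Metric.infDist x C = ε} := by
  intro a ha
  rw [Set.mem_ofPred_eq] at ha
  obtain ⟨g, hg, hin⟩ := exists_projection_displacement hne hcl hconv
  have hlip := lipschitzWith_projection_displacement hg hin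
  set e := ε⁻¹ • g a with he
  have he1 : ‖e‖ = 1 := by
    rw [he, norm_smul, ← norm_projection_displacement hconv hg hin, ha, Real.norm_eq_abs,
      abs_of_pos (inv_pos.2 hε), inv_mul_cancel₀ hε.ne']
  have hee : inner ℝ e e = (1 : ℝ) := by rw [real_inner_self_eq_norm_sq, he1, one_pow]
  -- replace the `e`-coordinate by a rescaled defining function of the level set
  set σ : EuclideanSpace ℝ (Fin n) → EuclideanSpace ℝ (Fin n) := fun x =>
    x + (ε⁻¹ * (Metric.infDist x C ^ 2 / 2) - ε / 2 - inner ℝ e x) • e with hσdef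
  have hder : ∀ x, HasFDerivAt σ (ContinuousLinearMap.id ℝ _ +
      (innerSL ℝ (ε⁻¹ • g x - e)).smulRight e) x := by
    intro x
    have h1 := ((hasFDerivAt_half_infDist_sq hconv hg hin x).const_mul ε⁻¹).sub_const (ε / 2)
    have h2 := (h1.sub (innerSL ℝ e).hasFDerivAt).smul_const e
    have h3 : innerSL ℝ (ε⁻¹ • g x - e) = ε⁻¹ • innerSL ℝ (g x) - innerSL ℝ e := by
      ext1 v
      simp
    rw [h3]
    exact (hasFDerivAt_id x).add h2
  have hfd : fderiv ℝ σ = fun x => ContinuousLinearMap.id ℝ _ +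
      (innerSL ℝ (ε⁻¹ • g x - e)).smulRight e := funext fun x => (hder x).fderiv
  have hK : LipschitzWith (Real.toNNReal ε⁻¹) (fderiv ℝ σ) := by
    refine LipschitzWith.of_dist_le_mul fun x y => ?_
    have hdiff : fderiv ℝ σ x - fderiv ℝ σ y =
        (innerSL ℝ (ε⁻¹ • (g x - g y))).smulRight e := by
      rw [hfd]
      ext1 v
      simp only [sub_apply, add_apply,
        ContinuousLinearMap.smulRight_apply, innerSL_apply_apply, inner_sub_left, smul_sub]
      module
    have hxy := hlip.dist_le_mul x y
    rw [NNReal.coe_one, one_mul, dist_eq_norm (g x)] at hxy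
    rw [dist_eq_norm, hdiff, ContinuousLinearMap.norm_smulRight_apply, he1, mul_one,
      innerSL_apply_norm, norm_smul, Real.coe_toNNReal _ (inv_pos.2 hε).le, Real.norm_eq_abs,
      abs_of_pos (inv_pos.2 hε)]
    gcongr
  have hσ : ContDiff ℝ 1 σ :=
    contDiff_one_iff_fderiv.2 ⟨fun x => (hder x).differentiableAt, hK.continuous⟩
  have hid : fderiv ℝ σ a = ContinuousLinearMap.id ℝ _ := by
    rw [hfd]
    ext1 v
    simp [← he]
  obtain ⟨U, hUo, haU, τ, hτ⟩ := exists_isC11DiffeoOn hσ hK hid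
  refine ⟨U, hUo, haU, (ℝ ∙ e)ᗮ, ?_, σ, τ, hτ, ?_⟩
  · have h := (ℝ ∙ e).finrank_add_finrank_orthogonal
    rw [finrank_span_singleton (by rintro h0; simp [h0] at he1), finrank_euclideanSpace_fin] at h
    omega
  · have hmem : ∀ x, σ x ∈ (ℝ ∙ e)ᗮ ↔ Metric.infDist x C = ε := by
      intro x
      rw [Submodule.mem_orthogonal_singleton_iff_inner_right, hσdef]
      simp only [inner_add_right, inner_smul_right, hee]
      have hx := Metric.infDist_nonneg (x := x) (s := C)
      rw [show inner ℝ e x + (ε⁻¹ * (Metric.infDist x C ^ 2 / 2) - ε / 2 - inner ℝ e x) * 1 =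
        (Metric.infDist x C ^ 2 - ε ^ 2) / (2 * ε) by field_simp; ring]
      rw [div_eq_zero_iff, or_iff_left (by positivity), sub_eq_zero,
        pow_left_inj₀ hx hε.le two_ne_zero]
    ext y
    constructor
    · rintro ⟨x, ⟨hxU, hx⟩, rfl⟩
      exact ⟨(hmem x).2 hx, x, hxU, rfl⟩
    · rintro ⟨hy, x, hxU, rfl⟩
      exact ⟨x, ⟨hxU, (hmem x).1 hy⟩, rfl⟩

lemma singularSet_frontier_subset_parallel {n : ℕ} {C : Set (EuclideanSpace ℝ (Fin n))}
    (hcl : IsClosed C) (hconv : Convex ℝ C) (hint : (interior C).Nonempty) {ε : ℝ}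
    (hε : 0 < ε) :
    singularSet (frontier C) ⊆ singularSet (frontier {x | Metric.infDist x C ≤ ε}) := by
  rintro x ⟨hx, hsing⟩
  have hne := hint.mono interior_subset
  have hxC : x ∈ C := by
    by_contra hxC
    refine hsing ((differentiableAt_infDist_of_notMem hne hcl hconv hxC).congr_of_eventuallyEq ?_)
    filter_upwards [hcl.isOpen_compl.mem_nhds hxC] with y hy
    exact infDist_frontier_of_notMem hne hcl hy
  have hfr : (frontier C).Nonempty := by
    by_contra h
    rw [Set.not_nonempty_iff_eq_empty] at h
    simp [h, Metric.infDist_empty] at hsing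
  have hxi : x ∈ interior C := by
    by_contra h
    exact hx ⟨subset_closure hxC, h⟩
  refine ⟨fun h => ?_, fun h => hsing ?_⟩
  · rw [frontier_infDist_le hne hcl hconv hε, Set.mem_ofPred_eq,
      Metric.infDist_zero_of_mem hxC] at h
    exact hε.ne h
  · refine (h.sub_const ε).congr_of_eventuallyEq ?_
    filter_upwards [mem_interior_iff_mem_nhds.1 hxi] with y hy
    rw [infDist_frontier_parallel hcl hconv hint hε hfr hy, add_sub_cancel_right]

/-- For a convex body `C` and `ε > 0`, the outer parallel body `C_ε = {x : δ_C(x) ≤ ε}` is a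
convex body, its boundary is a `C^{1,1}`-hypersurface, and `Σ(∂C) ⊆ Σ(∂C_ε)`. -/
theorem parallel_body_C11_and_singular_monotone {n : ℕ}
    (C : Set (EuclideanSpace ℝ (Fin n))) (hC : IsCompact C) (hconv : Convex ℝ C)
    (hint : (interior C).Nonempty) (ε : ℝ) (hε : 0 < ε) :
    IsCompact {x | Metric.infDist x C ≤ ε} ∧
    Convex ℝ {x | Metric.infDist x C ≤ ε} ∧
    (interior {x | Metric.infDist x C ≤ ε}).Nonempty ∧
    IsC11Hypersurface (frontier {x | Metric.infDist x C ≤ ε}) ∧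
    singularSet (frontier C) ⊆ singularSet (frontier {x | Metric.infDist x C ≤ ε}) := by
  have hne : C.Nonempty := hint.mono interior_subset
  have hcl := hC.isClosed
  have hth : {x | Metric.infDist x C ≤ ε} = Metric.cthickening ε C := by
    ext x
    rw [hC.cthickening_eq_biUnion_closedBall hε.le]
    simp only [Set.mem_iUnion, Metric.mem_closedBall, exists_prop, Set.mem_ofPred_eq]
    refine ⟨fun h => ?_, fun ⟨c, hc, hd⟩ => (Metric.infDist_le_dist_of_mem hc).trans hd⟩
    obtain ⟨c, hc, hd⟩ := hC.exists_infDist_eq_dist hne x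
    exact ⟨c, hc, hd ▸ h⟩
  refine ⟨hth ▸ hC.cthickening, hth ▸ hconv.cthickening ε,
    hint.mono (interior_mono fun x hx => ?_), ?_,
    singularSet_frontier_subset_parallel hcl hconv hint hε⟩
  · rw [Set.mem_ofPred_eq, Metric.infDist_zero_of_mem hx]
    exact hε.le
  · rw [frontier_infDist_le hne hcl hconv hε]
    exact isC11Hypersurface_setOf_infDist_eq hne hcl hconv hε
end
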